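/- arXiv:1804.01360 — 3 statements merged into one kernel-verified Lean document; each statement's English description precedes it below -/
import Mathlib

section
/- Let p > 3 be prime and let λ : M₁ → Perm(M₁) denote the left regular representation (left translations). The number of regular subgroups N of Perm(M₁) such that N is isomorphic to M₁ and N is normalized by the image λ(M₁) equals (2p³ − 3p + 1)p². (By the Greither–Pareigis theorem, this is the number of Hopf–Galois structures of type M₁ on a Galois field extension with Galois group M₁.) -/
/-! ## The Heisenberg group of order `p³` -/

@[ext]
structure Heisenberg (p : ℕ) where
  x : ZMod p
  y : ZMod p
  z : ZMod p

namespace Heisenberg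

variable {p : ℕ}

instance : Mul (Heisenberg p) :=
  ⟨fun g h => ⟨g.x + h.x, g.y + h.y, g.z + h.z + h.x * g.y⟩⟩

instance : One (Heisenberg p) := ⟨⟨0, 0, 0⟩⟩

instance : Inv (Heisenberg p) := ⟨fun g => ⟨-g.x, -g.y, -g.z + g.x * g.y⟩⟩

@[simp] theorem mul_x (g h : Heisenberg p) : (g * h).x = g.x + h.x := rfl
@[simp] theorem mul_y (g h : Heisenberg p) : (g * h).y = g.y + h.y := rfl
@[simp] theorem mul_z (g h : Heisenberg p) : (g * h).z = g.z + h.z + h.x * g.y := rfl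
@[simp] theorem one_x : (1 : Heisenberg p).x = 0 := rfl
@[simp] theorem one_y : (1 : Heisenberg p).y = 0 := rfl
@[simp] theorem one_z : (1 : Heisenberg p).z = 0 := rfl
@[simp] theorem inv_x (g : Heisenberg p) : (g⁻¹).x = -g.x := rfl
@[simp] theorem inv_y (g : Heisenberg p) : (g⁻¹).y = -g.y := rfl
@[simp] theorem inv_z (g : Heisenberg p) : (g⁻¹).z = -g.z + g.x * g.y := rfl

instance : Group (Heisenberg p) where
  mul_assoc a b c := by ext <;> simp <;> ring
  one_mul a := by ext <;> simp
  mul_one a := by ext <;> simp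
  inv_mul_cancel a := by ext <;> simp <;> ring

/-- The generator `ρ` (a generator of the centre). -/
def ρ : Heisenberg p := ⟨0, 0, 1⟩

/-- The generator `σ`. -/
def σ : Heisenberg p := ⟨1, 0, 0⟩

/-- The generator `τ`. -/
def τ : Heisenberg p := ⟨0, 1, 0⟩

/-- The automorphism `α₁` determined by `σ ↦ ρσ`, `τ ↦ τ` (and `ρ ↦ ρ`). -/
def α₁ : MulAut (Heisenberg p) where
  toFun g := ⟨g.x, g.y, g.z + g.x⟩
  invFun g := ⟨g.x, g.y, g.z - g.x⟩
  left_inv g := by ext <;> simp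
  right_inv g := by ext <;> simp
  map_mul' g h := by ext <;> simp <;> ring

/-- The automorphism `α₃` determined by `σ ↦ σ`, `τ ↦ ρτ` (and `ρ ↦ ρ`). -/
def α₃ : MulAut (Heisenberg p) where
  toFun g := ⟨g.x, g.y, g.z + g.y⟩
  invFun g := ⟨g.x, g.y, g.z - g.y⟩
  left_inv g := by ext <;> simp
  right_inv g := by ext <;> simp
  map_mul' g h := by ext <;> simp <;> ring

/-- The automorphism `α₂` determined by `σ ↦ στ`, `τ ↦ τ` (and `ρ ↦ ρ`), for `p` an odd
prime. -/
def α₂ (p : ℕ) [Fact p.Prime] (hp : p ≠ 2) : MulAut (Heisenberg p) where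
  toFun g := ⟨g.x, g.x + g.y, g.z + g.x * (g.x - 1) / 2⟩
  invFun g := ⟨g.x, g.y - g.x, g.z - g.x * (g.x - 1) / 2⟩
  left_inv g := by ext <;> simp <;> ring
  right_inv g := by ext <;> simp <;> ring
  map_mul' g h := by
    have h2 : (2 : ZMod p) ≠ 0 := by
      intro h
      have h' : ((2 : ℕ) : ZMod p) = 0 := by exact_mod_cast h
      rw [CharP.cast_eq_zero_iff (ZMod p) p 2] at h'
      have h1 := Nat.le_of_dvd (by norm_num) h'
      have h2 := (Fact.out : p.Prime).two_le
      omega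
    ext <;> simp
    · ring
    · field_simp
      ring

end Heisenberg

open Heisenberg

/-! ## The holomorph of `M₁` inside the permutation group -/

/-- The left regular representation `M₁ → Perm M₁`. -/
def leftMulHom (p : ℕ) : Heisenberg p →* Equiv.Perm (Heisenberg p) :=
  MulAction.toPermHom (Heisenberg p) (Heisenberg p)

/-- The holomorph of `M₁`, realized as the subgroup of `Perm M₁` generated by left
translations and automorphisms of `M₁`. -/
def Hol (p : ℕ) : Subgroup (Equiv.Perm (Heisenberg p)) :=
  (leftMulHom p).range ⊔
    (MulAut.toPerm (Heisenberg p)).range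

/-- A subgroup of `Perm X` is regular if it acts freely and transitively on `X`. -/
def IsRegularSub {X : Type*} (H : Subgroup (Equiv.Perm X)) : Prop :=
  ∀ x y : X, ∃! g : Equiv.Perm X, g ∈ H ∧ g x = y

/-- The canonical projection `Θ : Hol(M₁) → Aut(M₁)` (with kernel the left translations),
written as a function on permutations: it sends `π` to `m ↦ (π 1)⁻¹ * π m`; on elements of the
holomorph, this is exactly the automorphism component. -/
def theta (p : ℕ) (π : Equiv.Perm (Heisenberg p)) : Equiv.Perm (Heisenberg p) :=
  (Equiv.mulLeft (π 1))⁻¹ * π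

/-- The cardinality of the image `Θ(G)` of a subgroup `G` of the holomorph under the canonical
projection `Θ`. -/
noncomputable def thetaCard (p : ℕ) (G : Subgroup (Equiv.Perm (Heisenberg p))) : ℕ :=
  Nat.card (theta p '' (G : Set (Equiv.Perm (Heisenberg p))))

/-- The conjugation action of `Aut(M₁)` (viewed inside `Perm M₁`) on subgroups of `Perm M₁`. -/
def autConj (p : ℕ) (α : MulAut (Heisenberg p)) (G : Subgroup (Equiv.Perm (Heisenberg p))) :
    Subgroup (Equiv.Perm (Heisenberg p)) :=
  Subgroup.map (MulAut.conj (MulAut.toPerm (Heisenberg p) α)).toMonoidHom G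

/-! ## Counting regular subgroups through skew brace operations -/

theorem Nat.card_eq_mul_of_fiber_equiv {α β γ : Type*} (f : α → β)
    (h : ∀ b, Nonempty ({a // f a = b} ≃ γ)) : Nat.card α = Nat.card β * Nat.card γ := by
  rw [← Nat.card_prod]
  exact Nat.card_congr ((Equiv.sigmaFiberEquiv f).symm.trans
    ((Equiv.sigmaCongrRight fun b => (h b).some).trans (Equiv.sigmaEquivProd β γ)))

/-- The operations on the group `H` that make it a skew brace (with `H` as additive group)
whose multiplicative group is isomorphic to `G`. -/
def braceOps (H G : Type*) [Group H] [Group G] : Set (H → H → H) :=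
  {m | (∃ φ : H ≃ G, ∀ g h, φ (m g h) = φ g * φ h) ∧
    ∀ g h k, m g (h * k) = m g h * g⁻¹ * m g k}

/-- The bijections `H ≃ G` along which the group law of `G` pulls back to a skew brace
operation on `H`. -/
def BraceEquiv (H G : Type*) [Group H] [Group G] : Type _ :=
  {φ : H ≃ G // ∀ g h k, φ.symm (φ g * φ (h * k)) =
    φ.symm (φ g * φ h) * g⁻¹ * φ.symm (φ g * φ k)}

namespace BraceEquiv

variable {H G : Type*} [Group H]

/-- The regular representation of `H` on `G` attached to a bijection `H ≃ G`. -/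
def regHom (φ : H ≃ G) : H →* Equiv.Perm G :=
  φ.permCongrHom.toMonoidHom.comp (MulAction.toPermHom H H)

theorem regHom_apply (φ : H ≃ G) (h x : H) : regHom φ h (φ x) = φ (h * x) := by
  simp [regHom, Equiv.permCongrHom]

theorem regHom_injective (φ : H ≃ G) : Function.Injective (regHom φ) := by
  intro a b hab
  have := congrArg (fun f : Equiv.Perm G => f (φ 1)) hab
  simpa [regHom_apply] using this

theorem isRegularSub_range_regHom (φ : H ≃ G) : IsRegularSub (regHom φ).range := by
  intro x y
  obtain ⟨a, rfl⟩ := φ.surjective x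
  obtain ⟨b, rfl⟩ := φ.surjective y
  refine ⟨regHom φ (b * a⁻¹), ⟨⟨_, rfl⟩,
    by rw [regHom_apply, inv_mul_cancel_right]⟩, ?_⟩
  rintro _ ⟨⟨c, rfl⟩, hc⟩
  rw [regHom_apply, φ.injective.eq_iff] at hc
  rw [← hc, mul_inv_cancel_right]

variable [Group G]

theorem map_one (φ : BraceEquiv H G) : φ.1 1 = 1 := by
  have h := φ.2 (φ.1.symm 1) 1 1
  rw [mul_one] at h
  have h' : φ.1.symm 1 = 1 := by simpa using h.symm
  rw [← h', Equiv.apply_symm_apply]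

/-- The skew brace operation attached to a bijection. -/
def op (φ : BraceEquiv H G) : braceOps H G :=
  ⟨fun g h => φ.1.symm (φ.1 g * φ.1 h), ⟨φ.1, fun g h => by simp⟩, φ.2⟩

theorem op_fiber (m : braceOps H G) : Nonempty ({φ : BraceEquiv H G // φ.op = m} ≃ MulAut G) := by
  obtain ⟨m, ⟨φ₀, hφ₀⟩, hm⟩ := m
  have key : ∀ φ : BraceEquiv H G, φ.op.1 = m → ∀ g h, φ.1 (m g h) = φ.1 g * φ.1 h := by
    rintro φ rfl g h
    simp [op]
  refine ⟨⟨fun φ => ⟨φ₀.symm.trans φ.1.1, fun x y => ?_⟩,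
    fun α => ⟨⟨φ₀.trans α.toEquiv, ?_⟩, ?_⟩, fun φ => ?_, fun α => ?_⟩⟩
  · obtain ⟨g, rfl⟩ := φ₀.surjective x
    obtain ⟨h, rfl⟩ := φ₀.surjective y
    simp [← hφ₀, key φ.1 (congrArg Subtype.val φ.2)]
  · intro g h k
    simpa [← map_mul, ← hφ₀] using hm g h k
  · apply Subtype.ext
    funext g h
    simp [op, ← map_mul, ← hφ₀]
  · apply Subtype.ext
    apply Subtype.ext
    ext x
    simp
  · ext x
    simp

theorem exists_braceEquiv (e : H ≃* G) {N : Subgroup (Equiv.Perm G)} (hr : IsRegularSub N)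
    (hi : Nonempty (N ≃* G)) (hn : ∀ g : G, ∀ n ∈ N,
      MulAction.toPermHom G G g * n * (MulAction.toPermHom G G g)⁻¹ ∈ N) :
    ∃ φ : BraceEquiv H G, (regHom φ.1).range = N := by
  obtain ⟨i⟩ := hi
  let f : H ≃* N := e.trans i.symm
  have hb : Function.Bijective fun h : H => (f h : Equiv.Perm G) 1 := by
    constructor
    · intro a b hab
      apply f.injective
      apply Subtype.ext
      exact (hr 1 ((f b : Equiv.Perm G) 1)).unique ⟨(f a).2, hab⟩ ⟨(f b).2, rfl⟩
    · intro y
      obtain ⟨g, ⟨hg, hy⟩, -⟩ := hr 1 y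
      exact ⟨f.symm ⟨g, hg⟩, by simpa using hy⟩
  let φ : H ≃ G := Equiv.ofBijective _ hb
  have hφ : ∀ h x, (f h : Equiv.Perm G) (φ x) = φ (h * x) := by
    intro h x
    simp [φ]
  have hreg : ∀ h, regHom φ h = f h := by
    intro h
    ext y
    obtain ⟨x, rfl⟩ := φ.surjective y
    rw [regHom_apply, hφ]
  refine ⟨⟨φ, fun g h k => ?_⟩, ?_⟩
  · have hmem := hn (φ g) (f h) (f h).2
    obtain ⟨h', hh'⟩ : ∃ h', (f h' : Equiv.Perm G) =
        MulAction.toPermHom G G (φ g) * f h * (MulAction.toPermHom G G (φ g))⁻¹ :=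
      ⟨f.symm ⟨_, hmem⟩, by simp⟩
    have key : ∀ x, φ.symm (φ g * φ (h * x)) = h' * φ.symm (φ g * φ x) := by
      intro x
      rw [Equiv.symm_apply_eq, ← hφ h', Equiv.apply_symm_apply, hh', ← hφ h]
      simp
    have h1 : φ.symm (φ g * φ 1) = g := by simp [φ]
    have hh := key 1
    rw [h1, mul_one] at hh
    rw [key, hh, mul_inv_cancel_right]
  · ext n
    constructor
    · rintro ⟨h, rfl⟩
      rw [hreg]
      exact (f h).2
    · intro h
      exact ⟨f.symm ⟨n, h⟩, by rw [hreg]; simp⟩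

theorem regHom_range_normalized (φ : BraceEquiv H G) (g : G) (n : Equiv.Perm G)
    (hn : n ∈ (regHom φ.1).range) :
    MulAction.toPermHom G G g * n * (MulAction.toPermHom G G g)⁻¹ ∈ (regHom φ.1).range := by
  obtain ⟨h, rfl⟩ := hn
  obtain ⟨u, rfl⟩ := φ.1.surjective g
  refine ⟨φ.1.symm (φ.1 u * φ.1 h) * u⁻¹, ?_⟩
  rw [eq_mul_inv_iff_mul_eq]
  ext y
  obtain ⟨x, rfl⟩ := φ.1.surjective y
  have h2 := φ.2 u h x
  simp only [Equiv.Perm.mul_apply, MulAction.toPermHom_apply, MulAction.toPerm_apply, smul_eq_mul,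
    regHom_apply]
  rw [← φ.1.apply_symm_apply (φ.1 u * φ.1 x), regHom_apply, ← h2, Equiv.apply_symm_apply]

theorem regHom_fiber (φ₀ : BraceEquiv H G) :
    Nonempty ({φ : BraceEquiv H G // (regHom φ.1).range = (regHom φ₀.1).range} ≃ MulAut H) := by
  refine ⟨⟨fun φ => ⟨φ.1.1.trans φ₀.1.symm, fun h x => ?_⟩,
    fun α => ⟨⟨α.toEquiv.trans φ₀.1, ?_⟩, ?_⟩, fun φ => ?_, fun α => ?_⟩⟩
  · obtain ⟨φ, hφ⟩ := φ
    obtain ⟨k, hk⟩ : regHom φ.1 h ∈ (regHom φ₀.1).range := hφ ▸ ⟨h, rfl⟩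
    have key : ∀ x, φ₀.1.symm (φ.1 (h * x)) = k * φ₀.1.symm (φ.1 x) := by
      intro x
      rw [← regHom_apply, Equiv.symm_apply_eq, ← regHom_apply, hk, Equiv.apply_symm_apply]
    have h1 := key 1
    rw [φ.map_one, mul_one, ← φ₀.map_one, Equiv.symm_apply_apply, mul_one] at h1
    simp [key, h1]
  · intro g h k
    simpa using congrArg α.symm (φ₀.2 (α g) (α h) (α k))
  · have key : ∀ h, regHom (α.toEquiv.trans φ₀.1) h = regHom φ₀.1 (α h) := by
      intro h
      ext y
      obtain ⟨x, rfl⟩ := (α.toEquiv.trans φ₀.1).surjective y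
      rw [regHom_apply]
      simp [regHom_apply]
    ext n
    constructor
    · rintro ⟨h, rfl⟩
      exact ⟨α h, (key h).symm⟩
    · rintro ⟨h, rfl⟩
      exact ⟨α.symm h, (key (α.symm h)).trans (by simp)⟩
  · apply Subtype.ext
    apply Subtype.ext
    ext x
    simp
  · ext x
    simp

end BraceEquiv

/-- Byott's translation: for `H ≃* G`, the regular subgroups of `Perm G` isomorphic to `G` and
normalized by left translations are equinumerous with the skew brace operations on `H` whose
multiplicative group is isomorphic to `G`. -/
theorem card_regular_normalized_eq_card_braceOps {H G : Type*} [Group H] [Group G] [Finite G]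
    (e : H ≃* G) :
    Nat.card {N : Subgroup (Equiv.Perm G) // IsRegularSub N ∧ Nonempty (N ≃* G) ∧
      ∀ g : G, ∀ n ∈ N, MulAction.toPermHom G G g * n * (MulAction.toPermHom G G g)⁻¹ ∈ N} =
    Nat.card (braceOps H G) := by
  have h1 := Nat.card_eq_mul_of_fiber_equiv (BraceEquiv.op (H := H) (G := G)) BraceEquiv.op_fiber
  let F : BraceEquiv H G → {N : Subgroup (Equiv.Perm G) // IsRegularSub N ∧ Nonempty (N ≃* G) ∧
      ∀ g : G, ∀ n ∈ N, MulAction.toPermHom G G g * n * (MulAction.toPermHom G G g)⁻¹ ∈ N} :=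
    fun φ => ⟨(BraceEquiv.regHom φ.1).range, BraceEquiv.isRegularSub_range_regHom φ.1,
      ⟨(MonoidHom.ofInjective (BraceEquiv.regHom_injective φ.1)).symm.trans e⟩,
      BraceEquiv.regHom_range_normalized φ⟩
  have h2 := Nat.card_eq_mul_of_fiber_equiv (γ := MulAut H) F fun N => by
    obtain ⟨N, hr, hi, hn⟩ := N
    obtain ⟨φ₀, rfl⟩ := BraceEquiv.exists_braceEquiv e hr hi hn
    obtain ⟨E⟩ := BraceEquiv.regHom_fiber φ₀
    exact ⟨(Equiv.subtypeEquivRight fun φ => by simp [F]).trans E⟩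
  rw [Nat.card_congr (MulAut.congr e).toEquiv, h1] at h2
  have : Finite (MulAut G) := Finite.of_injective (fun α => (α : G → G)) DFunLike.coe_injective
  exact (Nat.eq_of_mul_eq_mul_right Nat.card_pos h2).symm


theorem ZMod.apply_eq_mul_of_add {p : ℕ} {f : ZMod p → ZMod p} (hf : ∀ s t, f (s + t) = f s + f t)
    (t : ZMod p) : f t = f 1 * t := by
  have := (AddMonoidHom.toZModLinearMap p (AddMonoidHom.mk' f hf)).map_smul t 1
  simpa [mul_comm] using this

theorem ZMod.two_ne_zero_of_three_lt {p : ℕ} (h3 : 3 < p) : (2 : ZMod p) ≠ 0 := by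
  intro h
  have h' : ((2 : ℕ) : ZMod p) = 0 := by exact_mod_cast h
  rw [ZMod.natCast_eq_zero_iff] at h'
  have := Nat.le_of_dvd (by norm_num) h'
  omega

theorem ZMod.three_ne_zero_of_three_lt {p : ℕ} (h3 : 3 < p) : (3 : ZMod p) ≠ 0 := by
  intro h
  have h' : ((3 : ℕ) : ZMod p) = 0 := by exact_mod_cast h
  rw [ZMod.natCast_eq_zero_iff] at h'
  have := Nat.le_of_dvd (by norm_num) h'
  omega

/-! ## The Heisenberg group in symmetric coordinates -/

/-- The Heisenberg group with group law `(v, z) (w, t) = (v + w, z + t + v ∧ w)`. -/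
@[ext]
structure SymHeisenberg (p : ℕ) where
  x : ZMod p
  y : ZMod p
  z : ZMod p

namespace SymHeisenberg

variable {p : ℕ}

instance : Mul (SymHeisenberg p) :=
  ⟨fun g h => ⟨g.x + h.x, g.y + h.y, g.z + h.z + g.x * h.y - g.y * h.x⟩⟩

instance : One (SymHeisenberg p) := ⟨⟨0, 0, 0⟩⟩

instance : Inv (SymHeisenberg p) := ⟨fun g => ⟨-g.x, -g.y, -g.z⟩⟩

@[simp] theorem mul_x (g h : SymHeisenberg p) : (g * h).x = g.x + h.x := rfl
@[simp] theorem mul_y (g h : SymHeisenberg p) : (g * h).y = g.y + h.y := rfl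
@[simp] theorem mul_z (g h : SymHeisenberg p) :
    (g * h).z = g.z + h.z + g.x * h.y - g.y * h.x := rfl
@[simp] theorem one_x : (1 : SymHeisenberg p).x = 0 := rfl
@[simp] theorem one_y : (1 : SymHeisenberg p).y = 0 := rfl
@[simp] theorem one_z : (1 : SymHeisenberg p).z = 0 := rfl
@[simp] theorem inv_x (g : SymHeisenberg p) : (g⁻¹).x = -g.x := rfl
@[simp] theorem inv_y (g : SymHeisenberg p) : (g⁻¹).y = -g.y := rfl
@[simp] theorem inv_z (g : SymHeisenberg p) : (g⁻¹).z = -g.z := rfl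

instance : Group (SymHeisenberg p) where
  mul_assoc a b c := by ext <;> simp <;> ring
  one_mul a := by ext <;> simp
  mul_one a := by ext <;> simp
  inv_mul_cancel a := by ext <;> simp; ring

/-- Transport of an operation along an automorphism. -/
def transportOp (α : SymHeisenberg p ≃* SymHeisenberg p)
    (m : SymHeisenberg p → SymHeisenberg p → SymHeisenberg p) (g h : SymHeisenberg p) :
    SymHeisenberg p :=
  α (m (α.symm g) (α.symm h))

theorem transportOp_symm_transportOp (α : SymHeisenberg p ≃* SymHeisenberg p)
    (m : SymHeisenberg p → SymHeisenberg p → SymHeisenberg p) :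
    transportOp α.symm (transportOp α m) = m := by
  funext g h
  simp [transportOp]

theorem transportOp_transportOp_symm (α : SymHeisenberg p ≃* SymHeisenberg p)
    (m : SymHeisenberg p → SymHeisenberg p → SymHeisenberg p) :
    transportOp α (transportOp α.symm m) = m := by
  funext g h
  simp [transportOp]

theorem transportOp_mem (α : SymHeisenberg p ≃* SymHeisenberg p)
    {m : SymHeisenberg p → SymHeisenberg p → SymHeisenberg p}
    (hm : m ∈ braceOps (SymHeisenberg p) (Heisenberg p)) :
    transportOp α m ∈ braceOps (SymHeisenberg p) (Heisenberg p) := by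
  obtain ⟨⟨φ, hφ⟩, hm⟩ := hm
  refine ⟨⟨α.symm.toEquiv.trans φ, fun g h => ?_⟩, fun g h k => ?_⟩
  · simp [transportOp, hφ]
  · simp [transportOp, hm]

variable [Fact p.Prime]

/-- The Heisenberg group in symmetric coordinates is the Heisenberg group. -/
def equivHeisenberg (h2 : (2 : ZMod p) ≠ 0) : SymHeisenberg p ≃* Heisenberg p where
  toFun g := ⟨g.x, g.y, -(g.z - g.x * g.y) / 2⟩
  invFun g := ⟨g.x, g.y, -2 * g.z + g.x * g.y⟩
  left_inv g := by
    ext <;> simp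
    field_simp
    ring
  right_inv g := by
    ext <;> simp
    field_simp
  map_mul' g h := by
    ext <;> simp
    field_simp
    ring

theorem exists_linear_of_additive (h2 : (2 : ZMod p) ≠ 0) {f : SymHeisenberg p → ZMod p}
    (hf : ∀ g h, f (g * h) = f g + f h) : ∃ α β, ∀ g, f g = α * g.x + β * g.y := by
  have hx := ZMod.apply_eq_mul_of_add (f := fun t => f ⟨t, 0, 0⟩) fun s t => by
    rw [← hf]; congr 1; ext <;> simp
  have hy := ZMod.apply_eq_mul_of_add (f := fun t => f ⟨0, t, 0⟩) fun s t => by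
    rw [← hf]; congr 1; ext <;> simp
  have hz := ZMod.apply_eq_mul_of_add (f := fun t => f ⟨0, 0, t⟩) fun s t => by
    rw [← hf]; congr 1; ext <;> simp
  have hc : f ⟨0, 0, 2⟩ = 0 := by
    have h1 : (⟨0, 0, 2⟩ * (⟨0, 1, 0⟩ * ⟨1, 0, 0⟩) : SymHeisenberg p) =
        ⟨1, 0, 0⟩ * ⟨0, 1, 0⟩ := by
      ext <;> simp; norm_num
    have := congrArg f h1
    rw [hf, hf, hf] at this
    linear_combination this
  have hc1 : f ⟨0, 0, 1⟩ = 0 := by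
    have := hz 2
    simp only [hc] at this
    simpa [h2] using this.symm
  refine ⟨f ⟨1, 0, 0⟩, f ⟨0, 1, 0⟩, fun g => ?_⟩
  have hg : g = ⟨0, 0, g.z - g.x * g.y⟩ * (⟨g.x, 0, 0⟩ * ⟨0, g.y, 0⟩) := by
    ext <;> simp
  rw [hg, hf, hf, hx g.x, hy g.y, hz, hc1]
  simp

theorem endomorphism_apply (h2 : (2 : ZMod p) ≠ 0) {θ : SymHeisenberg p → SymHeisenberg p}
    (hθ : ∀ g h, θ (g * h) = θ g * θ h) :
    ∃ a b c d e f, ∀ g, θ g = ⟨a * g.x + b * g.y, c * g.x + d * g.y,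
      (a * d - b * c) * g.z + e * g.x + f * g.y⟩ := by
  obtain ⟨a, b, hx⟩ := exists_linear_of_additive h2 (f := fun g => (θ g).x)
    fun g h => by simp [hθ]
  obtain ⟨c, d, hy⟩ := exists_linear_of_additive h2 (f := fun g => (θ g).y)
    fun g h => by simp [hθ]
  obtain ⟨e, f, hz⟩ := exists_linear_of_additive h2
    (f := fun g => (θ g).z - (a * d - b * c) * g.z)
    fun g h => by
      simp only [hθ, mul_z, hx, hy]
      ring
  refine ⟨a, b, c, d, e, f, fun g => ?_⟩
  ext
  · exact hx g
  · exact hy g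
  · linear_combination hz g

end SymHeisenberg

theorem Heisenberg.exists_linear_of_additive {p : ℕ} {f : Heisenberg p → ZMod p}
    (hf : ∀ g h, f (g * h) = f g + f h) : ∃ α β, ∀ g, f g = α * g.x + β * g.y := by
  have hx := ZMod.apply_eq_mul_of_add (f := fun t => f ⟨t, 0, 0⟩) fun s t => by
    rw [← hf]; congr 1; ext <;> simp
  have hy := ZMod.apply_eq_mul_of_add (f := fun t => f ⟨0, t, 0⟩) fun s t => by
    rw [← hf]; congr 1; ext <;> simp
  have hz := ZMod.apply_eq_mul_of_add (f := fun t => f ⟨0, 0, t⟩) fun s t => by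
    rw [← hf]; congr 1; ext <;> simp
  have hc : f ⟨0, 0, 1⟩ = 0 := by
    have h1 : (⟨0, 0, 1⟩ * (⟨1, 0, 0⟩ * ⟨0, 1, 0⟩) : Heisenberg p) =
        ⟨0, 1, 0⟩ * ⟨1, 0, 0⟩ := by
      ext <;> simp
    have := congrArg f h1
    rw [hf, hf, hf] at this
    linear_combination this
  refine ⟨f ⟨1, 0, 0⟩, f ⟨0, 1, 0⟩, fun g => ?_⟩
  have hg : g = ⟨0, 0, g.z⟩ * (⟨g.x, 0, 0⟩ * ⟨0, g.y, 0⟩) := by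
    ext <;> simp
  rw [hg, hf, hf, hx g.x, hy g.y, hz, hc]
  simp

theorem Heisenberg.card_eq (p : ℕ) [NeZero p] : Nat.card (Heisenberg p) = p ^ 3 := by
  let e : Heisenberg p ≃ ZMod p × ZMod p × ZMod p :=
    ⟨fun g => (g.x, g.y, g.z), fun t => ⟨t.1, t.2.1, t.2.2⟩, fun _ => rfl, fun _ => rfl⟩
  rw [Nat.card_congr e, Nat.card_prod, Nat.card_prod, Nat.card_zmod]
  ring

instance Heisenberg.finite (p : ℕ) [NeZero p] : Finite (Heisenberg p) :=
  Nat.finite_of_card_ne_zero (by rw [Heisenberg.card_eq]; exact pow_ne_zero 3 (NeZero.ne p))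

/-! ## Operations isomorphic to the Heisenberg group -/

section HeisenbergOp

variable {p : ℕ} {H : Type*} {m : H → H → H} (φ : H ≃ Heisenberg p)
  (hφ : ∀ g h, φ (m g h) = φ g * φ h)

include hφ

theorem op_assoc_of_equiv (g h k : H) : m (m g h) k = m g (m h k) := by
  apply φ.injective
  simp only [hφ, mul_assoc]

theorem exists_op_right_eq (u w : H) : ∃ c, m u c = w :=
  ⟨φ.symm ((φ u)⁻¹ * φ w), φ.injective (by simp [hφ])⟩

variable [Fact p.Prime]

theorem exists_op_not_comm : ∃ g h, m g h ≠ m h g := by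
  refine ⟨φ.symm ⟨1, 0, 0⟩, φ.symm ⟨0, 1, 0⟩, fun h => ?_⟩
  have := congrArg (fun g => (φ g).z) h
  simp [hφ] at this

theorem additive_eq_linear {f : H → ZMod p} (hf : ∀ g h, f (m g h) = f g + f h) :
    ∃ α β, ∀ g, f g = α * (φ g).x + β * (φ g).y := by
  obtain ⟨α, β, h⟩ := Heisenberg.exists_linear_of_additive (f := fun g => f (φ.symm g))
    fun g h => by rw [← hf]; congr 1; apply φ.injective; simp [hφ]
  exact ⟨α, β, fun g => by simpa using h (φ g)⟩

variable {f₁ f₂ : H → ZMod p} (h₁ : ∀ g h, f₁ (m g h) = f₁ g + f₁ h)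
  (h₂ : ∀ g h, f₂ (m g h) = f₂ g + f₂ h)
  (hi : ∀ α β, (∀ g, α * f₁ g + β * f₂ g = 0) → α = 0 ∧ β = 0)

include h₁ h₂ hi

theorem exists_coordinates : ∃ α₁ β₁ α₂ β₂, α₁ * β₂ - α₂ * β₁ ≠ 0 ∧
    (∀ g, f₁ g = α₁ * (φ g).x + β₁ * (φ g).y) ∧ ∀ g, f₂ g = α₂ * (φ g).x + β₂ * (φ g).y := by
  obtain ⟨α₁, β₁, e₁⟩ := additive_eq_linear φ hφ h₁
  obtain ⟨α₂, β₂, e₂⟩ := additive_eq_linear φ hφ h₂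
  refine ⟨α₁, β₁, α₂, β₂, fun hdet => ?_, e₁, e₂⟩
  obtain ⟨hβ₂, hβ₁⟩ := hi β₂ (-β₁) fun g => by
    rw [e₁, e₂]; linear_combination (φ g).x * hdet
  obtain ⟨hα₂, hα₁⟩ := hi α₂ (-α₁) fun g => by
    rw [e₁, e₂]; linear_combination -(φ g).y * hdet
  rw [neg_eq_zero] at hβ₁ hα₁
  have := (hi 1 0 fun g => by rw [e₁, hα₁, hβ₁]; ring).1
  exact one_ne_zero this

theorem additive_eq_combination {f : H → ZMod p} (hf : ∀ g h, f (m g h) = f g + f h) :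
    ∃ α β, ∀ g, f g = α * f₁ g + β * f₂ g := by
  obtain ⟨α₁, β₁, α₂, β₂, hdet, e₁, e₂⟩ := exists_coordinates φ hφ h₁ h₂ hi
  obtain ⟨α, β, e⟩ := additive_eq_linear φ hφ hf
  refine ⟨(α * β₂ - β * α₂) / (α₁ * β₂ - α₂ * β₁), (α₁ * β - β₁ * α) / (α₁ * β₂ - α₂ * β₁),
    fun g => ?_⟩
  rw [e, e₁, e₂, eq_comm, div_mul_eq_mul_div, div_mul_eq_mul_div, ← add_div, div_eq_iff hdet]
  ring

theorem op_comm_of_eq_zero {z : H} (hz₁ : f₁ z = 0) (hz₂ : f₂ z = 0) (g : H) :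
    m z g = m g z := by
  obtain ⟨α₁, β₁, α₂, β₂, hdet, e₁, e₂⟩ := exists_coordinates φ hφ h₁ h₂ hi
  rw [e₁] at hz₁
  rw [e₂] at hz₂
  have hx : (φ z).x = 0 := by
    apply (mul_eq_zero.1 _).resolve_left hdet
    linear_combination β₂ * hz₁ - β₁ * hz₂
  have hy : (φ z).y = 0 := by
    apply (mul_eq_zero.1 _).resolve_left hdet
    linear_combination α₁ * hz₂ - α₂ * hz₁
  apply φ.injective
  rw [hφ, hφ]
  ext <;> simp [hx, hy, add_comm]

end HeisenbergOp

/-! ## Skew brace operations fixing a line -/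

namespace SymHeisenberg

variable {p : ℕ} [Fact p.Prime]

/-- The operation `g ∘ h = g * γ_g h`, where `γ_g` is the automorphism
`(x, y, z) ↦ (x, y + χ g * x, z + a g * x + b g * y)`. -/
def shearOp (χ a b : SymHeisenberg p → ZMod p) (g h : SymHeisenberg p) : SymHeisenberg p :=
  ⟨g.x + h.x, g.y + h.y + χ g * h.x,
    g.z + h.z + a g * h.x + b g * h.y + g.x * (h.y + χ g * h.x) - g.y * h.x⟩

theorem shearOp_mul (χ a b : SymHeisenberg p → ZMod p) (g h k : SymHeisenberg p) :
    shearOp χ a b g (h * k) = shearOp χ a b g h * g⁻¹ * shearOp χ a b g k := by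
  ext <;> simp [shearOp] <;> ring

/-- The shear operations whose automorphisms are trivial modulo the centre. -/
def centralOp (a₁ b₁ b₂ : ZMod p) (d : (ZMod p)ˣ) :
    SymHeisenberg p → SymHeisenberg p → SymHeisenberg p :=
  shearOp (fun _ => 0) (fun g => a₁ * g.x + (d + b₁ + 2) * g.y) (fun g => b₁ * g.x + b₂ * g.y)

/-- The shear operations whose shear factor is a nonzero multiple of `x`. -/
def proportionalOp (k : (ZMod p)ˣ) (a₁ b₁ : ZMod p) (d : (ZMod p)ˣ) :
    SymHeisenberg p → SymHeisenberg p → SymHeisenberg p :=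
  shearOp (fun g => k * g.x)
    (fun g => k * b₁ * g.x ^ 2 / 2 + a₁ * g.x + (d + b₁ + 2) * (g.y - k * g.x ^ 2 / 2))
    (fun g => b₁ * g.x)

/-- The shear factor of `independentOp`. -/
def independentShear (a₁ a₂ e₁ : ZMod p) (e₂ : (ZMod p)ˣ) (g : SymHeisenberg p) : ZMod p :=
  (g.z - a₁ * g.x ^ 2 / 2 - a₂ * g.y - e₁ * g.x) / e₂

/-- The shear operations whose shear factor is not a multiple of `x`. -/
def independentOp (a₁ a₂ e₁ : ZMod p) (e₂ : (ZMod p)ˣ) :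
    SymHeisenberg p → SymHeisenberg p → SymHeisenberg p :=
  shearOp (independentShear a₁ a₂ e₁ e₂)
    (fun g => g.y - g.x * independentShear a₁ a₂ e₁ e₂ g + a₁ * g.x +
      a₂ * independentShear a₁ a₂ e₁ e₂ g)
    (fun g => -g.x)

theorem centralOp_mem (h3 : 3 < p) (a₁ b₁ b₂ : ZMod p) (d : (ZMod p)ˣ) :
    centralOp a₁ b₁ b₂ d ∈ braceOps (SymHeisenberg p) (Heisenberg p) := by
  have h2 := ZMod.two_ne_zero_of_three_lt h3
  have hd := d.ne_zero
  refine ⟨⟨⟨fun g => ⟨g.x, g.y,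
      (g.z - (b₁ + 1) * g.x * g.y - a₁ * g.x ^ 2 / 2 - b₂ * g.y ^ 2 / 2) / d⟩,
    fun g => ⟨g.x, g.y,
      g.z * d + (b₁ + 1) * g.x * g.y + a₁ * g.x ^ 2 / 2 + b₂ * g.y ^ 2 / 2⟩,
    fun g => ?_, fun g => ?_⟩, fun g h => ?_⟩, shearOp_mul _ _ _⟩
  · ext <;> simp
    field_simp
    ring
  · ext <;> simp
    field_simp
    ring
  · ext <;> simp [centralOp, shearOp]
    field_simp
    ring

theorem proportionalOp_mem (h3 : 3 < p) (k : (ZMod p)ˣ) (a₁ b₁ : ZMod p) (d : (ZMod p)ˣ) :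
    proportionalOp k a₁ b₁ d ∈ braceOps (SymHeisenberg p) (Heisenberg p) := by
  have h2 := ZMod.two_ne_zero_of_three_lt h3
  have h3' := ZMod.three_ne_zero_of_three_lt h3
  have hd := d.ne_zero
  refine ⟨⟨⟨fun g => ⟨g.x, g.y - k * g.x ^ 2 / 2,
      (g.z - (b₁ + 1) * g.x * (g.y - k * g.x ^ 2 / 2) - k * (b₁ + 1) * g.x ^ 3 / (2 * 3)
        - a₁ * g.x ^ 2 / 2) / d⟩,
    fun g => ⟨g.x, g.y + k * g.x ^ 2 / 2,
      g.z * d + (b₁ + 1) * g.x * g.y + k * (b₁ + 1) * g.x ^ 3 / (2 * 3) + a₁ * g.x ^ 2 / 2⟩,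
    fun g => ?_, fun g => ?_⟩, fun g h => ?_⟩, shearOp_mul _ _ _⟩
  · ext <;> simp
    field_simp
    ring
  · ext <;> simp
    field_simp
    ring
  · ext <;> simp [proportionalOp, shearOp]
    · field_simp
      ring
    · field_simp
      ring

theorem independentOp_mem (h3 : 3 < p) (a₁ a₂ e₁ : ZMod p) (e₂ : (ZMod p)ˣ) :
    independentOp a₁ a₂ e₁ e₂ ∈ braceOps (SymHeisenberg p) (Heisenberg p) := by
  have h2 := ZMod.two_ne_zero_of_three_lt h3
  have he := e₂.ne_zero
  refine ⟨⟨⟨fun g => ⟨g.x, independentShear a₁ a₂ e₁ e₂ g, g.y⟩,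
    fun g => ⟨g.x, g.z, g.y * e₂ + a₁ * g.x ^ 2 / 2 + a₂ * g.z + e₁ * g.x⟩,
    fun g => ?_, fun g => ?_⟩, fun g h => ?_⟩, shearOp_mul _ _ _⟩
  · ext <;> simp [independentShear]
    ring
  · ext <;> simp [independentShear]
    field_simp
    ring
  · ext <;> simp [independentOp, independentShear, shearOp]
    · field_simp
      ring
    · ring

/-- A shear operation isomorphic to the Heisenberg group belongs to one of three explicit
families. -/
theorem shearOp_classification (h2 : (2 : ZMod p) ≠ 0) {χ a b : SymHeisenberg p → ZMod p}
    (φ : SymHeisenberg p ≃ Heisenberg p)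
    (hφ : ∀ g h, φ (shearOp χ a b g h) = φ g * φ h) :
    (∃ a₁ b₁ b₂ d, shearOp χ a b = centralOp a₁ b₁ b₂ d) ∨
    (∃ k a₁ b₁ d, shearOp χ a b = proportionalOp k a₁ b₁ d) ∨
    ∃ a₁ a₂ e₁ e₂, shearOp χ a b = independentOp a₁ a₂ e₁ e₂ := by
  have hassoc := op_assoc_of_equiv φ hφ
  have hχ : ∀ g h, χ (shearOp χ a b g h) = χ g + χ h := fun g h => by
    have := congrArg SymHeisenberg.y (hassoc g h ⟨1, 0, 0⟩)
    simp only [shearOp] at this ⊢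
    linear_combination this
  have hb : ∀ g h, b (shearOp χ a b g h) = b g + b h := fun g h => by
    have := congrArg SymHeisenberg.z (hassoc g h ⟨0, 1, 0⟩)
    simp only [shearOp] at this ⊢
    linear_combination this
  have ha : ∀ g h, a (shearOp χ a b g h) = a g + a h + b g * χ h := fun g h => by
    have := congrArg SymHeisenberg.z (hassoc g h ⟨1, 0, 0⟩)
    have hc := hχ g h
    simp only [shearOp] at this hc ⊢
    linear_combination this - (g.x + h.x) * hc
  have hx : ∀ g h, (shearOp χ a b g h).x = g.x + h.x := fun g h => rfl
  have hy : ∀ g h, (shearOp χ a b g h).y = g.y + h.y + χ g * h.x := fun g h => rfl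
  have hz : ∀ g h, (shearOp χ a b g h).z = g.z + h.z + a g * h.x + b g * h.y +
    g.x * (h.y + χ g * h.x) - g.y * h.x := fun g h => rfl
  obtain ⟨u, w, huw⟩ := exists_op_not_comm φ hφ
  generalize hm : shearOp χ a b = m at *
  by_cases hk : ∃ k, ∀ g, χ g = k * g.x
  · obtain ⟨k, hk⟩ := hk
    have hY : ∀ g h, (m g h).y - k * (m g h).x ^ 2 / 2 =
        (g.y - k * g.x ^ 2 / 2) + (h.y - k * h.x ^ 2 / 2) := fun g h => by
      rw [hx, hy, hk]
      field_simp
      ring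
    have hi : ∀ α β, (∀ g : SymHeisenberg p, α * g.x + β * (g.y - k * g.x ^ 2 / 2) = 0) →
        α = 0 ∧ β = 0 := fun α β h => by
      have h01 := h ⟨0, 1, 0⟩
      have h10 := h ⟨1, 0, 0⟩
      simp at h01
      simp [h01] at h10
      exact ⟨h10, h01⟩
    obtain ⟨b₁, b₂, eb⟩ := additive_eq_combination φ hφ hx hY hi hb
    have haz : ∀ t, a ⟨0, 0, t⟩ = 0 := fun t => by
      have h1 := op_comm_of_eq_zero φ hφ hx hY hi (z := ⟨0, 0, t⟩) rfl (by simp) ⟨1, 0, 0⟩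
      have h2 := congrArg SymHeisenberg.z h1
      simpa [hz, eb, hk] using h2
    have hacomm : ∀ g h, a (m g h) = a (m h g) := fun g h => by
      obtain ⟨c, hc⟩ := exists_op_right_eq φ hφ (m h g) (m g h)
      have hcx : c.x = 0 := by
        have := hx (m h g) c
        rw [hc, hx, hx] at this
        linear_combination -this
      have hcy : c.y = 0 := by
        have := hY (m h g) c
        rw [hc, hY, hY, hcx] at this
        linear_combination -this
      have hac : a c = 0 := by
        rw [← haz c.z]
        congr 1
        ext <;> simp [hcx, hcy]
      rw [← hc, ha, hac, hk c, hcx]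
      ring
    have hkb : k * b₂ = 0 := by
      have := hacomm ⟨0, 1, 0⟩ ⟨1, 0, 0⟩
      rw [ha, ha, eb, eb, hk, hk] at this
      simp at this
      linear_combination this
    have hE : ∀ g h, a (m g h) - k * b₁ * (m g h).x ^ 2 / 2 =
        (a g - k * b₁ * g.x ^ 2 / 2) + (a h - k * b₁ * h.x ^ 2 / 2) := fun g h => by
      rw [ha, hx, eb, hk]
      field_simp
      linear_combination (2 * g.y - k * g.x ^ 2) * h.x * hkb
    obtain ⟨a₁, a₂, ea⟩ := additive_eq_combination φ hφ hx hY hi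
      (f := fun g => a g - k * b₁ * g.x ^ 2 / 2) hE
    have hd : a₂ - b₁ - 2 ≠ 0 := fun hd => by
      apply huw
      ext
      · rw [hx, hx]; ring
      · rw [hy, hy, hk, hk]; ring
      · have e1 := ea u
        have e2 := ea w
        rw [sub_eq_iff_eq_add] at e1 e2
        rw [hz, hz, e1, e2, eb, eb, hk, hk]
        rcases mul_eq_zero.1 hkb with h0 | h0
        · rw [h0]
          linear_combination (u.y * w.x - w.y * u.x) * hd
        · rw [h0]
          field_simp
          linear_combination ((2 * u.y - k * u.x ^ 2) * w.x - (2 * w.y - k * w.x ^ 2) * u.x) * hd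
    by_cases hk0 : k = 0
    · left
      refine ⟨a₁, b₁, b₂, Units.mk0 _ hd, ?_⟩
      rw [← hm, centralOp]
      congr 1
      · funext g
        rw [hk, hk0, zero_mul]
      · funext g
        have := ea g
        simp only [hk0] at this
        rw [Units.val_mk0]
        linear_combination this
      · funext g
        rw [eb, hk0]
        ring
    · right; left
      have hb₂ : b₂ = 0 := (mul_eq_zero.1 hkb).resolve_left hk0
      refine ⟨Units.mk0 k hk0, a₁, b₁, Units.mk0 _ hd, ?_⟩
      rw [← hm, proportionalOp]
      congr 1
      · funext g
        exact hk g
      · funext g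
        rw [Units.val_mk0, Units.val_mk0]
        linear_combination ea g
      · funext g
        rw [eb, hb₂]
        ring
  · right; right
    have hi : ∀ α β, (∀ g : SymHeisenberg p, α * g.x + β * χ g = 0) →
        α = 0 ∧ β = 0 := fun α β h => by
      have hβ : β = 0 := by
        by_contra hβ
        refine hk ⟨-α / β, fun g => ?_⟩
        field_simp
        linear_combination h g
      have h10 := h ⟨1, 0, 0⟩
      simp [hβ] at h10
      exact ⟨h10, hβ⟩
    obtain ⟨b₁, b₂, eb⟩ := additive_eq_combination φ hφ hx hχ hi hb
    have hE : ∀ g h, a (m g h) + b₁ * ((m g h).y - (m g h).x * χ (m g h)) - b₂ * χ (m g h) ^ 2 / 2 =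
        (a g + b₁ * (g.y - g.x * χ g) - b₂ * χ g ^ 2 / 2) +
        (a h + b₁ * (h.y - h.x * χ h) - b₂ * χ h ^ 2 / 2) := fun g h => by
      rw [ha, hx, hy, hχ, eb]
      field_simp
      ring
    obtain ⟨a₁, a₂, ea⟩ := additive_eq_combination φ hφ hx hχ hi
      (f := fun g => a g + b₁ * (g.y - g.x * χ g) - b₂ * χ g ^ 2 / 2) hE
    obtain ⟨c, hcx, hcχ, hcy⟩ : ∃ c : SymHeisenberg p, c.x = 0 ∧ χ c = 0 ∧ c.y ≠ 0 := by
      obtain ⟨g, h, hgh⟩ : ∃ g h : SymHeisenberg p, χ g * h.x - χ h * g.x ≠ 0 := by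
        by_contra! hcon
        refine hk ⟨χ ⟨1, 0, 0⟩, fun g => ?_⟩
        have := hcon g ⟨1, 0, 0⟩
        simp only at this
        linear_combination this
      obtain ⟨c, hc⟩ := exists_op_right_eq φ hφ (m h g) (m g h)
      have hcx : c.x = 0 := by
        have := hx (m h g) c
        rw [hc, hx, hx] at this
        linear_combination -this
      have hcχ : χ c = 0 := by
        have := hχ (m h g) c
        rw [hc, hχ, hχ] at this
        linear_combination -this
      refine ⟨c, hcx, hcχ, fun hcy => hgh ?_⟩
      have := hy (m h g) c
      rw [hc, hy, hy, hcx, hcy] at this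
      linear_combination this
    have hac : a c = -b₁ * c.y := by
      have := ea c
      rw [hcx, hcχ] at this
      linear_combination this
    obtain ⟨hb₁, hb₂⟩ := hi (2 * (b₁ + 1)) b₂ fun g => by
      have h1 := congrArg SymHeisenberg.z (op_comm_of_eq_zero φ hφ hx hχ hi hcx hcχ g)
      rw [hz, hz, hac, eb c, eb g, hcx, hcχ] at h1
      apply (mul_eq_zero.1 _).resolve_left hcy
      linear_combination -h1
    replace hb₁ : b₁ = -1 := by
      linear_combination (mul_eq_zero.1 hb₁).resolve_left h2
    subst hb₁ hb₂
    have ea' : ∀ g, a g = g.y - g.x * χ g + a₁ * g.x + a₂ * χ g := fun g => by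
      linear_combination ea g
    have hS : ∀ g h, (m g h).z - a₁ * (m g h).x ^ 2 / 2 - a₂ * (m g h).y =
        (g.z - a₁ * g.x ^ 2 / 2 - a₂ * g.y) + (h.z - a₁ * h.x ^ 2 / 2 - a₂ * h.y) :=
      fun g h => by
        rw [hx, hy, hz, eb, ea']
        field_simp
        ring
    obtain ⟨e₁, e₂, es⟩ := additive_eq_combination φ hφ hx hχ hi
      (f := fun g => g.z - a₁ * g.x ^ 2 / 2 - a₂ * g.y) hS
    have he : e₂ ≠ 0 := fun he => by
      have := es ⟨0, 0, 1⟩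
      simp [he] at this
    have eχ : χ = independentShear a₁ a₂ e₁ (Units.mk0 e₂ he) := by
      funext g
      rw [independentShear, Units.val_mk0, eq_div_iff he]
      linear_combination -es g
    refine ⟨a₁, a₂, e₁, Units.mk0 e₂ he, ?_⟩
    rw [← hm, independentOp, ← eχ]
    congr 1
    · funext g
      exact ea' g
    · funext g
      rw [eb]
      ring

/-! ## Fixed lines of skew brace operations -/

/-- `FixesVector m u` says that all the maps `h ↦ g⁻¹ * m g h` fix the vector `(u.x, u.y)`. -/
def FixesVector (m : SymHeisenberg p → SymHeisenberg p → SymHeisenberg p)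
    (u : SymHeisenberg p) : Prop :=
  ∀ g, (m g u).x = g.x + u.x ∧ (m g u).y = g.y + u.y

theorem exists_matrix_of_mem_braceOps (h2 : (2 : ZMod p) ≠ 0)
    {m : SymHeisenberg p → SymHeisenberg p → SymHeisenberg p}
    (hm : m ∈ braceOps (SymHeisenberg p) (Heisenberg p)) :
    ∃ a b c d e f : SymHeisenberg p → ZMod p, ∀ g h, m g h = g * ⟨a g * h.x + b g * h.y,
      c g * h.x + d g * h.y, (a g * d g - b g * c g) * h.z + e g * h.x + f g * h.y⟩ := by
  have key := fun g => endomorphism_apply h2 (θ := fun h => g⁻¹ * m g h) fun h k => by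
    rw [hm.2]; group
  choose a b c d e f h using key
  exact ⟨a, b, c, d, e, f, fun g k => by rw [← h, mul_inv_cancel_left]⟩

theorem FixesVector.of_combination (h2 : (2 : ZMod p) ≠ 0)
    {m : SymHeisenberg p → SymHeisenberg p → SymHeisenberg p}
    (hm : m ∈ braceOps (SymHeisenberg p) (Heisenberg p)) {u w v : SymHeisenberg p}
    (hu : FixesVector m u) (hw : FixesVector m w) (α β : ZMod p)
    (hx : v.x = α * u.x + β * w.x) (hy : v.y = α * u.y + β * w.y) : FixesVector m v := by
  obtain ⟨a, b, c, d, e, f, h⟩ := exists_matrix_of_mem_braceOps h2 hm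
  intro g
  obtain ⟨hu₁, hu₂⟩ := hu g
  obtain ⟨hw₁, hw₂⟩ := hw g
  simp only [h, mul_x, mul_y, hx, hy] at *
  constructor
  · linear_combination α * hu₁ + β * hw₁
  · linear_combination α * hu₂ + β * hw₂

theorem FixesVector.of_independent (h2 : (2 : ZMod p) ≠ 0)
    {m : SymHeisenberg p → SymHeisenberg p → SymHeisenberg p}
    (hm : m ∈ braceOps (SymHeisenberg p) (Heisenberg p)) {u w : SymHeisenberg p}
    (hu : FixesVector m u) (hw : FixesVector m w) (h : u.x * w.y - u.y * w.x ≠ 0)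
    (v : SymHeisenberg p) : FixesVector m v := by
  refine hu.of_combination h2 hm hw ((v.x * w.y - v.y * w.x) / (u.x * w.y - u.y * w.x))
    ((u.x * v.y - u.y * v.x) / (u.x * w.y - u.y * w.x)) ?_ ?_
  all_goals
    rw [eq_comm, div_mul_eq_mul_div, div_mul_eq_mul_div, ← add_div, div_eq_iff h]
    ring

/-- The automorphisms attached to a skew brace operation of Heisenberg type have a common
nonzero fixed vector. -/
theorem exists_fixesVector (h2 : (2 : ZMod p) ≠ 0)
    {m : SymHeisenberg p → SymHeisenberg p → SymHeisenberg p}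
    (hm : m ∈ braceOps (SymHeisenberg p) (Heisenberg p)) :
    ∃ u, FixesVector m u ∧ (u.x ≠ 0 ∨ u.y ≠ 0) := by
  obtain ⟨a, b, c, d, e, f, h⟩ := exists_matrix_of_mem_braceOps h2 hm
  obtain ⟨⟨φ, hφ⟩, -⟩ := hm
  have hassoc := op_assoc_of_equiv φ hφ
  have hone : ∀ g, m (φ.symm 1) g = g := fun g => φ.injective (by simp [hφ])
  have hsymm : ∀ g h, φ.symm (g * h) = m (φ.symm g) (φ.symm h) := fun g h =>
    φ.injective (by simp [hφ])
  let act : MulAction (Heisenberg p) (ZMod p × ZMod p) :=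
    { smul := fun g v => (a (φ.symm g) * v.1 + b (φ.symm g) * v.2,
        c (φ.symm g) * v.1 + d (φ.symm g) * v.2)
      one_smul := fun v => by
        have h0 := hone 1
        have hv := hone ⟨v.1, v.2, 0⟩
        rw [h] at h0 hv
        have h0x := congrArg SymHeisenberg.x h0
        have h0y := congrArg SymHeisenberg.y h0
        have hvx := congrArg SymHeisenberg.x hv
        have hvy := congrArg SymHeisenberg.y hv
        simp only [mul_x, mul_y, one_x, one_y] at h0x h0y hvx hvy
        apply Prod.ext
        · change a (φ.symm 1) * v.1 + b (φ.symm 1) * v.2 = v.1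
          linear_combination hvx - h0x
        · change c (φ.symm 1) * v.1 + d (φ.symm 1) * v.2 = v.2
          linear_combination hvy - h0y
      mul_smul := fun g k v => by
        have hv := hassoc (φ.symm g) (φ.symm k) ⟨v.1, v.2, 0⟩
        rw [← hsymm] at hv
        have hgk := hsymm g k
        rw [h] at hgk
        have hgx := congrArg SymHeisenberg.x hgk
        have hgy := congrArg SymHeisenberg.y hgk
        have hvx := congrArg SymHeisenberg.x hv
        have hvy := congrArg SymHeisenberg.y hv
        simp only [h, mul_x, mul_y] at hgx hgy hvx hvy
        apply Prod.ext
        · change a (φ.symm (g * k)) * v.1 + b (φ.symm (g * k)) * v.2 =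
            a (φ.symm g) * (a (φ.symm k) * v.1 + b (φ.symm k) * v.2) +
            b (φ.symm g) * (c (φ.symm k) * v.1 + d (φ.symm k) * v.2)
          linear_combination hvx - hgx
        · change c (φ.symm (g * k)) * v.1 + d (φ.symm (g * k)) * v.2 =
            c (φ.symm g) * (a (φ.symm k) * v.1 + b (φ.symm k) * v.2) +
            d (φ.symm g) * (c (φ.symm k) * v.1 + d (φ.symm k) * v.2)
          linear_combination hvy - hgy }
  have hsmul : ∀ (g : SymHeisenberg p) (v : ZMod p × ZMod p),
      φ g • v = (a g * v.1 + b g * v.2, c g * v.1 + d g * v.2) := fun g v => by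
    change (a (φ.symm (φ g)) * v.1 + _, _) = _
    rw [φ.symm_apply_apply]
  obtain ⟨v, hv, hv0⟩ :=
    (IsPGroup.of_card (Heisenberg.card_eq p)).exists_fixed_point_of_prime_dvd_card_of_fixed_point
      (ZMod p × ZMod p) (by simp) (a := 0) fun g => by
        obtain ⟨g, rfl⟩ := φ.surjective g
        rw [hsmul]
        simp
  refine ⟨⟨v.1, v.2, 0⟩, fun g => ?_, ?_⟩
  · have := hv (φ g)
    rw [hsmul] at this
    have h1 := congrArg Prod.fst this
    have h2 := congrArg Prod.snd this
    simp only at h1 h2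
    simp [h, h1, h2]
  · by_contra! hcon
    exact hv0 (Prod.ext hcon.1.symm hcon.2.symm)

theorem eq_shearOp_of_fixesVector (h2 : (2 : ZMod p) ≠ 0)
    {m : SymHeisenberg p → SymHeisenberg p → SymHeisenberg p}
    (hm : m ∈ braceOps (SymHeisenberg p) (Heisenberg p)) (hfix : FixesVector m ⟨0, 1, 0⟩) :
    ∃ χ a b, m = shearOp χ a b := by
  obtain ⟨a, b, c, d, e, f, h⟩ := exists_matrix_of_mem_braceOps h2 hm
  have hb : ∀ g, b g = 0 := fun g => by
    simpa [h] using (hfix g).1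
  have hd : ∀ g, d g = 1 := fun g => by
    simpa [h] using (hfix g).2
  obtain ⟨⟨φ, hφ⟩, -⟩ := hm
  have hx : ∀ g k, (m g k).x = g.x + a g * k.x := fun g k => by
    rw [h, mul_x, hb]
    ring
  have ha : ∀ g k, a (m g k) = a g * a k := fun g k => by
    have := congrArg SymHeisenberg.x (op_assoc_of_equiv φ hφ g k ⟨1, 0, 0⟩)
    simp only [hx] at this
    linear_combination this
  have hone : ∀ g, m (φ.symm 1) g = g := fun g => φ.injective (by simp [hφ])
  let α : Heisenberg p →* ZMod p :=
    { toFun := fun g => a (φ.symm g)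
      map_one' := by
        have h0 := hx (φ.symm 1) 1
        have h1 := hx (φ.symm 1) ⟨1, 0, 0⟩
        rw [hone] at h0 h1
        simp only [one_x] at h0
        linear_combination h0 - h1
      map_mul' := fun g k => by
        rw [← ha]
        congr 1
        exact φ.injective (by simp [hφ]) }
  have hα : ∀ g, α g = 1 := fun g => by
    have h1 : g ^ p ^ 3 = 1 := by rw [← Heisenberg.card_eq p, pow_card_eq_one']
    have h3 : α g ^ p ^ 3 = α g := by
      rw [pow_succ, pow_succ, pow_one, pow_mul, pow_mul, ZMod.pow_card, ZMod.pow_card,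
        ZMod.pow_card]
    rw [← h3, ← map_pow, h1, map_one]
  have ha1 : ∀ g, a g = 1 := fun g => by
    simpa [α] using hα (φ g)
  refine ⟨c, fun g => e g, f, ?_⟩
  funext g k
  rw [h, ha1, hb, hd]
  ext <;> simp [shearOp] <;> ring

/-- The automorphism of the Heisenberg group attached to a matrix of determinant one. -/
def ofSL (a b c d : ZMod p) (h : a * d - b * c = 1) : SymHeisenberg p ≃* SymHeisenberg p where
  toFun g := ⟨a * g.x + b * g.y, c * g.x + d * g.y, g.z⟩
  invFun g := ⟨d * g.x - b * g.y, a * g.y - c * g.x, g.z⟩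
  left_inv g := by
    ext
    · linear_combination g.x * h
    · linear_combination g.y * h
    · rfl
  right_inv g := by
    ext
    · linear_combination g.x * h
    · linear_combination g.y * h
    · rfl
  map_mul' g k := by
    ext
    · simp only [mul_x, mul_y]; ring
    · simp only [mul_x, mul_y]; ring
    · simp only [mul_z]; linear_combination -(g.x * k.y - g.y * k.x) * h

theorem FixesVector.transportOp {a b c d : ZMod p} (h : a * d - b * c = 1)
    {m : SymHeisenberg p → SymHeisenberg p → SymHeisenberg p} {u : SymHeisenberg p}
    (hu : FixesVector m u) :
    FixesVector (transportOp (ofSL a b c d h) m) (ofSL a b c d h u) := by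
  intro g
  obtain ⟨g, rfl⟩ := (ofSL a b c d h).surjective g
  obtain ⟨h1, h2⟩ := hu g
  simp only [SymHeisenberg.transportOp, MulEquiv.symm_apply_apply]
  constructor
  · change a * (m g u).x + b * (m g u).y = (a * g.x + b * g.y) + (a * u.x + b * u.y)
    rw [h1, h2]
    ring
  · change c * (m g u).x + d * (m g u).y = (c * g.x + d * g.y) + (c * u.x + d * u.y)
    rw [h1, h2]
    ring

theorem ofSL_symm {a b c d : ZMod p} (h : a * d - b * c = 1) :
    (ofSL a b c d h).symm = ofSL d (-b) (-c) a (by linear_combination h) := by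
  ext g
  · change d * g.x - b * g.y = d * g.x + -b * g.y
    ring
  · change a * g.y - c * g.x = -c * g.x + a * g.y
    ring
  · rfl

theorem FixesVector.transportOp_symm {a b c d : ZMod p} (h : a * d - b * c = 1)
    {m : SymHeisenberg p → SymHeisenberg p → SymHeisenberg p} {u : SymHeisenberg p}
    (hu : FixesVector m u) :
    FixesVector (SymHeisenberg.transportOp (ofSL a b c d h).symm m) ((ofSL a b c d h).symm u) := by
  rw [ofSL_symm]
  exact hu.transportOp _

/-- An automorphism carrying the vector `(0, 1)` to a representative of a given line. -/
def lineAut : Option (ZMod p) → (SymHeisenberg p ≃* SymHeisenberg p)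
  | none => ofSL 1 0 0 1 (by ring)
  | some t => ofSL 0 1 (-1) t (by ring)

/-- A representative of a line. -/
def lineVector : Option (ZMod p) → SymHeisenberg p
  | none => ⟨0, 1, 0⟩
  | some t => ⟨1, t, 0⟩

theorem lineAut_apply (l : Option (ZMod p)) : lineAut l ⟨0, 1, 0⟩ = lineVector l := by
  cases l <;> simp [lineAut, lineVector, ofSL]

theorem lineAut_symm_apply (l : Option (ZMod p)) :
    (lineAut l).symm (lineVector l) = ⟨0, 1, 0⟩ := by
  rw [← lineAut_apply, MulEquiv.symm_apply_apply]

theorem FixesVector.transportOp_lineAut (l : Option (ZMod p))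
    {m : SymHeisenberg p → SymHeisenberg p → SymHeisenberg p} {u : SymHeisenberg p}
    (hu : FixesVector m u) : FixesVector (SymHeisenberg.transportOp (lineAut l) m) (lineAut l u) := by
  cases l
  · exact hu.transportOp (a := 1) (b := 0) (c := 0) (d := 1) (by ring)
  · exact hu.transportOp (a := 0) (b := 1) (c := -1) (by ring)

theorem FixesVector.transportOp_lineAut_symm (l : Option (ZMod p))
    {m : SymHeisenberg p → SymHeisenberg p → SymHeisenberg p} {u : SymHeisenberg p}
    (hu : FixesVector m u) :
    FixesVector (SymHeisenberg.transportOp (lineAut l).symm m) ((lineAut l).symm u) := by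
  cases l
  · exact hu.transportOp_symm (a := 1) (b := 0) (c := 0) (d := 1) (by ring)
  · exact hu.transportOp_symm (a := 0) (b := 1) (c := -1) (by ring)

theorem forall_fixesVector_transportOp_iff (l : Option (ZMod p))
    {m : SymHeisenberg p → SymHeisenberg p → SymHeisenberg p} :
    (∀ v, FixesVector (transportOp (lineAut l) m) v) ↔ ∀ v, FixesVector m v := by
  constructor
  · intro h v
    have := (h (lineAut l v)).transportOp_lineAut_symm l
    rwa [transportOp_symm_transportOp, MulEquiv.symm_apply_apply] at this
  · intro h v
    have := (h ((lineAut l).symm v)).transportOp_lineAut l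
    rwa [MulEquiv.apply_symm_apply] at this

theorem exists_fixesVector_lineVector (h2 : (2 : ZMod p) ≠ 0)
    {m : SymHeisenberg p → SymHeisenberg p → SymHeisenberg p}
    (hm : m ∈ braceOps (SymHeisenberg p) (Heisenberg p)) :
    ∃ l, FixesVector m (lineVector l) := by
  obtain ⟨u, hu, hne⟩ := exists_fixesVector h2 hm
  by_cases hx : u.x = 0
  · have hy := hne.resolve_left (not_not.2 hx)
    exact ⟨none, hu.of_combination h2 hm hu u.y⁻¹ 0 (by simp [lineVector, hx])
      (by simp [lineVector, hy])⟩
  · refine ⟨some (u.y / u.x), hu.of_combination h2 hm hu u.x⁻¹ 0 (by simp [lineVector, hx]) ?_⟩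
    simp [lineVector]
    field_simp

theorem lineVector_det_ne_zero {l l' : Option (ZMod p)} (h : l ≠ l') :
    (lineVector l).x * (lineVector l').y - (lineVector l).y * (lineVector l').x ≠ 0 := by
  cases l <;> cases l' <;> simp [lineVector, sub_eq_zero] at h ⊢
  exact fun e => h e.symm

/-! ## The count -/

/-- The parameters of the shear operations that are nontrivial modulo the centre. -/
abbrev ShearParam (p : ℕ) : Type :=
  ((ZMod p)ˣ × ZMod p × ZMod p × (ZMod p)ˣ) ⊕ (ZMod p × ZMod p × ZMod p × (ZMod p)ˣ)

/-- The shear operation with given parameters. -/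
def nontrivialOp : ShearParam p → SymHeisenberg p → SymHeisenberg p → SymHeisenberg p
  | .inl (k, a₁, b₁, d) => proportionalOp k a₁ b₁ d
  | .inr (a₁, a₂, e₁, e₂) => independentOp a₁ a₂ e₁ e₂

theorem shearOp_injective {χ a b χ' a' b' : SymHeisenberg p → ZMod p}
    (h : shearOp χ a b = shearOp χ' a' b') : χ = χ' ∧ a = a' ∧ b = b' := by
  have hχ : χ = χ' := by
    funext g
    have := congrArg SymHeisenberg.y (congrFun (congrFun h g) ⟨1, 0, 0⟩)
    simpa [shearOp] using this
  subst hχ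
  refine ⟨rfl, ?_, ?_⟩
  · funext g
    have := congrArg SymHeisenberg.z (congrFun (congrFun h g) ⟨1, 0, 0⟩)
    simpa [shearOp] using this
  · funext g
    have := congrArg SymHeisenberg.z (congrFun (congrFun h g) ⟨0, 1, 0⟩)
    simpa [shearOp] using this

theorem centralOp_injective {a₁ b₁ b₂ a₁' b₁' b₂' : ZMod p} {d d' : (ZMod p)ˣ}
    (h : centralOp a₁ b₁ b₂ d = centralOp a₁' b₁' b₂' d') :
    a₁ = a₁' ∧ b₁ = b₁' ∧ b₂ = b₂' ∧ d = d' := by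
  obtain ⟨-, ha, hb⟩ := shearOp_injective h
  have hb1 : b₁ = b₁' := by simpa using congrFun hb ⟨1, 0, 0⟩
  subst hb1
  refine ⟨by simpa using congrFun ha ⟨1, 0, 0⟩, rfl, by simpa using congrFun hb ⟨0, 1, 0⟩, ?_⟩
  exact Units.ext (by simpa using congrFun ha ⟨0, 1, 0⟩)

theorem independentShear_apply (a₁ a₂ e₁ : ZMod p) (e₂ : (ZMod p)ˣ) :
    independentShear a₁ a₂ e₁ e₂ ⟨0, 0, 1⟩ = (e₂ : ZMod p)⁻¹ := by
  rw [independentShear, div_eq_mul_inv]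
  ring

theorem independentShear_ne_zero (a₁ a₂ e₁ : ZMod p) (e₂ : (ZMod p)ˣ) :
    independentShear a₁ a₂ e₁ e₂ ⟨0, 0, 1⟩ ≠ 0 := by
  rw [independentShear_apply]
  exact inv_ne_zero e₂.ne_zero

theorem nontrivialOp_injective (h2 : (2 : ZMod p) ≠ 0) :
    Function.Injective (nontrivialOp (p := p)) := by
  rintro (⟨k, a₁, b₁, d⟩ | ⟨a₁, a₂, e₁, e₂⟩) (⟨k', a₁', b₁', d'⟩ | ⟨a₁', a₂', e₁', e₂'⟩) h
  · obtain ⟨hχ, ha, hb⟩ := shearOp_injective h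
    have hk : k = k' := Units.ext (by simpa using congrFun hχ ⟨1, 0, 0⟩)
    have hb1 : b₁ = b₁' := by simpa using congrFun hb ⟨1, 0, 0⟩
    subst hk hb1
    have hd : d = d' := Units.ext (by simpa using congrFun ha ⟨0, 1, 0⟩)
    subst hd
    have ha1 : a₁ = a₁' := by simpa using congrFun ha ⟨1, 0, 0⟩
    rw [ha1]
  · have hχ := congrFun (shearOp_injective h).1 ⟨0, 0, 1⟩
    exact independentShear_ne_zero a₁' a₂' e₁' e₂' (by rw [← hχ, mul_zero]) |>.elim
  · have hχ := congrFun (shearOp_injective h).1 ⟨0, 0, 1⟩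
    exact independentShear_ne_zero a₁ a₂ e₁ e₂ (by rw [hχ, mul_zero]) |>.elim
  · have hχ := (shearOp_injective h).1
    have he : e₂ = e₂' := by
      have := congrFun hχ ⟨0, 0, 1⟩
      rw [independentShear_apply, independentShear_apply, inv_inj] at this
      exact Units.ext this
    subst he
    have key : ∀ g : SymHeisenberg p, a₁ * g.x ^ 2 / 2 + a₂ * g.y + e₁ * g.x =
        a₁' * g.x ^ 2 / 2 + a₂' * g.y + e₁' * g.x := fun g => by
      have := congrFun hχ g
      simp only [independentShear] at this
      rw [div_left_inj' e₂.ne_zero] at this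
      linear_combination -this
    have ha2 : a₂ = a₂' := by simpa using key ⟨0, 1, 0⟩
    subst ha2
    have k1 := key ⟨1, 0, 0⟩
    have k2 := key ⟨-1, 0, 0⟩
    simp only at k1 k2
    have ha1 : a₁ = a₁' := by
      field_simp at k1 k2
      apply mul_left_cancel₀ h2
      linear_combination k1 + k2
    subst ha1
    have he1 : e₁ = e₁' := by linear_combination k1
    rw [he1]

theorem nontrivialOp_mem (h3 : 3 < p) (t : ShearParam p) :
    nontrivialOp t ∈ braceOps (SymHeisenberg p) (Heisenberg p) := by
  rcases t with ⟨k, a₁, b₁, d⟩ | ⟨a₁, a₂, e₁, e₂⟩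
  · exact proportionalOp_mem h3 k a₁ b₁ d
  · exact independentOp_mem h3 a₁ a₂ e₁ e₂

theorem fixesVector_shearOp (χ a b : SymHeisenberg p → ZMod p) :
    FixesVector (shearOp χ a b) ⟨0, 1, 0⟩ := fun g => by simp [shearOp]

theorem fixesVector_nontrivialOp (t : ShearParam p) :
    FixesVector (nontrivialOp t) ⟨0, 1, 0⟩ := by
  rcases t with ⟨k, a₁, b₁, d⟩ | ⟨a₁, a₂, e₁, e₂⟩ <;> exact fixesVector_shearOp _ _ _

theorem fixesVector_centralOp (a₁ b₁ b₂ : ZMod p) (d : (ZMod p)ˣ) (v : SymHeisenberg p) :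
    FixesVector (centralOp a₁ b₁ b₂ d) v := fun g => by simp [centralOp, shearOp]

theorem not_fixesVector_nontrivialOp (t : ShearParam p) :
    ¬ ∀ v, FixesVector (nontrivialOp t) v := by
  intro h
  have key := fun g => (h ⟨1, 0, 0⟩ g).2
  rcases t with ⟨k, a₁, b₁, d⟩ | ⟨a₁, a₂, e₁, e₂⟩
  · have := key ⟨1, 0, 0⟩
    simp [nontrivialOp, proportionalOp, shearOp] at this
  · have := key ⟨0, 0, 1⟩
    simp only [nontrivialOp, independentOp, shearOp] at this
    exact independentShear_ne_zero a₁ a₂ e₁ e₂ (by linear_combination this)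

/-- All skew brace operations of Heisenberg type on the Heisenberg group. -/
def paramOp : (ZMod p × ZMod p × ZMod p × (ZMod p)ˣ) ⊕ (Option (ZMod p) × ShearParam p) →
    SymHeisenberg p → SymHeisenberg p → SymHeisenberg p
  | .inl (a₁, b₁, b₂, d) => centralOp a₁ b₁ b₂ d
  | .inr (l, t) => transportOp (lineAut l) (nontrivialOp t)

theorem paramOp_injective (h3 : 3 < p) : Function.Injective (paramOp (p := p)) := by
  have h2 := ZMod.two_ne_zero_of_three_lt h3
  have hcentral : ∀ a₁ b₁ b₂ d l (t : ShearParam p),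
      centralOp a₁ b₁ b₂ d ≠ transportOp (lineAut l) (nontrivialOp t) := by
    intro a₁ b₁ b₂ d l t h
    refine not_fixesVector_nontrivialOp t ((forall_fixesVector_transportOp_iff l).1 fun v => ?_)
    rw [← h]
    exact fixesVector_centralOp _ _ _ _ v
  have hline : ∀ l (t : ShearParam p),
      FixesVector (transportOp (lineAut l) (nontrivialOp t)) (lineVector l) := by
    intro l t
    rw [← lineAut_apply]
    exact (fixesVector_nontrivialOp t).transportOp_lineAut l
  rintro (⟨a₁, b₁, b₂, d⟩ | ⟨l, t⟩) (⟨a₁', b₁', b₂', d'⟩ | ⟨l', t'⟩) h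
  · obtain ⟨rfl, rfl, rfl, rfl⟩ := centralOp_injective h
    rfl
  · exact (hcentral _ _ _ _ _ _ h).elim
  · exact (hcentral _ _ _ _ _ _ h.symm).elim
  · change transportOp (lineAut l) (nontrivialOp t) =
      transportOp (lineAut l') (nontrivialOp t') at h
    have hl : l = l' := by
      by_contra hl
      have h' := hline l' t'
      rw [← h] at h'
      exact not_fixesVector_nontrivialOp t ((forall_fixesVector_transportOp_iff l).1
        ((hline l t).of_independent h2 (transportOp_mem _ (nontrivialOp_mem h3 t)) h'
          (lineVector_det_ne_zero hl)))
    subst hl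
    have ht := congrArg (transportOp (lineAut l).symm) h
    rw [transportOp_symm_transportOp, transportOp_symm_transportOp] at ht
    rw [nontrivialOp_injective h2 ht]

theorem range_paramOp (h3 : 3 < p) :
    Set.range (paramOp (p := p)) = braceOps (SymHeisenberg p) (Heisenberg p) := by
  have h2 := ZMod.two_ne_zero_of_three_lt h3
  apply Set.Subset.antisymm
  · rintro _ ⟨⟨a₁, b₁, b₂, d⟩ | ⟨l, t⟩, rfl⟩
    · exact centralOp_mem h3 a₁ b₁ b₂ d
    · exact transportOp_mem _ (nontrivialOp_mem h3 t)
  · intro m hm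
    have key : ∀ {m : SymHeisenberg p → SymHeisenberg p → SymHeisenberg p},
        m ∈ braceOps (SymHeisenberg p) (Heisenberg p) → FixesVector m ⟨0, 1, 0⟩ →
        (∃ a₁ b₁ b₂ d, m = centralOp a₁ b₁ b₂ d) ∨ ∃ t, m = nontrivialOp t := by
      intro m hm hf
      obtain ⟨χ, a, b, rfl⟩ := eq_shearOp_of_fixesVector h2 hm hf
      obtain ⟨⟨φ, hφ⟩, -⟩ := hm
      rcases shearOp_classification h2 φ hφ with h | ⟨k, a₁, b₁, d, h⟩ | ⟨a₁, a₂, e₁, e₂, h⟩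
      · exact Or.inl h
      · exact Or.inr ⟨.inl (k, a₁, b₁, d), h⟩
      · exact Or.inr ⟨.inr (a₁, a₂, e₁, e₂), h⟩
    by_cases htriv : ∀ v, FixesVector m v
    · rcases key hm (htriv _) with ⟨a₁, b₁, b₂, d, rfl⟩ | ⟨t, rfl⟩
      · exact ⟨.inl (a₁, b₁, b₂, d), rfl⟩
      · exact (not_fixesVector_nontrivialOp t htriv).elim
    · obtain ⟨l, hl⟩ := exists_fixesVector_lineVector h2 hm
      have hl' := hl.transportOp_lineAut_symm l
      rw [lineAut_symm_apply] at hl'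
      have hm' := transportOp_transportOp_symm (lineAut l) m
      rcases key (transportOp_mem _ hm) hl' with ⟨a₁, b₁, b₂, d, h⟩ | ⟨t, h⟩
      · rw [h] at hm'
        refine (htriv ?_).elim
        rw [← hm', forall_fixesVector_transportOp_iff]
        exact fixesVector_centralOp _ _ _ _
      · exact ⟨.inr (l, t), by rw [← hm', h]; rfl⟩

theorem card_braceOps (h3 : 3 < p) :
    Nat.card (braceOps (SymHeisenberg p) (Heisenberg p)) = (2 * p ^ 3 - 3 * p + 1) * p ^ 2 := by
  rw [← range_paramOp h3, ← Nat.card_congr (Equiv.ofInjective _ (paramOp_injective h3))]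
  simp only [Nat.card_eq_fintype_card, Fintype.card_sum, Fintype.card_prod, Fintype.card_option,
    ZMod.card, ZMod.card_units_eq_totient, Nat.totient_prime (Fact.out : p.Prime)]
  obtain ⟨q, rfl⟩ : ∃ q, p = q + 1 := ⟨p - 1, by omega⟩
  have : 2 * (q + 1) ^ 3 - 3 * (q + 1) + 1 = 2 * q ^ 3 + 6 * q ^ 2 + 3 * q := by
    have : 2 * (q + 1) ^ 3 = 2 * q ^ 3 + 6 * q ^ 2 + 6 * q + 2 := by ring
    omega
  rw [this, Nat.add_sub_cancel]
  ring

end SymHeisenberg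


/-- The number of regular subgroups of `Perm(M₁)` isomorphic to `M₁` and
normalized by the image of the left regular representation of `M₁` equals `(2p³ − 3p + 1)p²`;
this is the number of Hopf–Galois structures of type `M₁` on a Galois extension with Galois
group `M₁`. -/
theorem hopf_galois_structures_M1_type_on_M1 (p : ℕ) [Fact p.Prime] (h3 : 3 < p) :
    Nat.card {N : Subgroup (Equiv.Perm (Heisenberg p)) //
      IsRegularSub N ∧ Nonempty (N ≃* Heisenberg p) ∧
      ∀ g : Heisenberg p, ∀ n ∈ N, leftMulHom p g * n * (leftMulHom p g)⁻¹ ∈ N} =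
    (2 * p ^ 3 - 3 * p + 1) * p ^ 2 := by
  rw [← SymHeisenberg.card_braceOps h3]
  exact card_regular_normalized_eq_card_braceOps
    (SymHeisenberg.equivHeisenberg (ZMod.two_ne_zero_of_three_lt h3))
end

section
/- Let p > 3 be prime, let G = (ZMod p)³ be the elementary abelian group of order p³, and let λ : G → Perm(G) denote the left regular representation. The number of regular subgroups N of Perm(G) such that N is isomorphic to the Heisenberg group M₁ and N is normalized by the image λ(G) equals (p³ − 1)(p² + p − 1)p². (By the Greither–Pareigis theorem, this is the number of Hopf–Galois structures of type M₁ on a Galois field extension with Galois group C_p³.) -/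
open Heisenberg

/-! ## Translations and regular subgroups -/

section Regular

variable {V : Type*} [AddCommGroup V]

/-- Translation by `a`, as a permutation of `V`. -/
def transl (a : V) : Equiv.Perm V := Equiv.addLeft a

@[simp] theorem transl_apply (a b : V) : transl a b = a + b := rfl

@[simp] theorem transl_inv_apply (a b : V) : (transl a)⁻¹ b = b - a := by
  rw [Equiv.Perm.inv_eq_iff_eq, transl_apply, add_sub_cancel]

@[simp] theorem transl_symm_apply (a b : V) : (transl a).symm b = b - a :=
  transl_inv_apply a b

theorem transl_add (a b : V) : transl (a + b) = transl a * transl b := by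
  ext x; simp [add_assoc]

theorem transl_zero : transl (0 : V) = 1 := by
  ext x; simp

theorem IsRegularSub.eq_of_apply_eq {X : Type*} {N : Subgroup (Equiv.Perm X)} (hN : IsRegularSub N)
    {σ τ : Equiv.Perm X} (hσ : σ ∈ N) (hτ : τ ∈ N) {x : X} (h : σ x = τ x) : σ = τ :=
  (hN x (τ x)).unique ⟨hσ, h⟩ ⟨hτ, rfl⟩

theorem IsRegularSub.exists_apply_eq {X : Type*} {N : Subgroup (Equiv.Perm X)}
    (hN : IsRegularSub N) (x y : X) : ∃ σ ∈ N, σ x = y :=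
  (hN x y).exists

theorem IsRegularSub.le_of_transitive {X : Type*} {N H : Subgroup (Equiv.Perm X)}
    (hN : IsRegularSub N) (hH : H ≤ N) (x : X) (h : ∀ y, ∃ σ ∈ H, σ x = y) : N ≤ H := by
  intro σ hσ
  obtain ⟨τ, hτ, hx⟩ := h (σ x)
  exact hN.eq_of_apply_eq (hH hτ) hσ hx ▸ hτ

/-- `N` is normalized by all translations. -/
def TranslNormalized (N : Subgroup (Equiv.Perm V)) : Prop :=
  ∀ a, ∀ σ ∈ N, transl a * σ * (transl a)⁻¹ ∈ N

/-- If a `p`-group of translations normalizes `A ≤ N` and `p` divides `[N : A]`, then some coset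
of `A` in `N`, other than `A`, is fixed under conjugation by translations. -/
theorem exists_fixed_coset {p : ℕ} [Fact p.Prime] (hV : IsPGroup p (Multiplicative V)) [Finite V]
    {A N : Subgroup (Equiv.Perm V)} (hA : TranslNormalized A)
    (hN : TranslNormalized N) (hdvd : p ∣ A.relIndex N) :
    ∃ σ ∈ N, σ ∉ A ∧ ∀ a, σ⁻¹ * (transl a * σ * (transl a)⁻¹) ∈ A := by
  let c (a : V) (n : N) : N := ⟨transl a * n * (transl a)⁻¹, hN a n n.2⟩
  have hc (a : V) (m n : N) (h : QuotientGroup.leftRel (A.subgroupOf N) m n) :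
      QuotientGroup.leftRel (A.subgroupOf N) (c a m) (c a n) := by
    rw [QuotientGroup.leftRel_apply, Subgroup.mem_subgroupOf] at h ⊢
    convert hA a _ h using 1
    simp only [c, Subgroup.coe_mul, Subgroup.coe_inv]
    group
  let act : MulAction (Multiplicative V) (N ⧸ A.subgroupOf N) :=
    { smul := fun a => Quotient.map (c a.toAdd) (hc a.toAdd)
      one_smul := by
        rintro ⟨n⟩
        refine congrArg (Quotient.mk _) (Subtype.ext ?_)
        simp [c, transl_zero]
      mul_smul := by
        rintro a b ⟨n⟩
        refine congrArg (Quotient.mk _) (Subtype.ext ?_)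
        simp [c, transl_add, mul_assoc] }
  have h1 : (QuotientGroup.mk (1 : N) : N ⧸ A.subgroupOf N) ∈
      MulAction.fixedPoints (Multiplicative V) (N ⧸ A.subgroupOf N) := by
    intro a
    refine congrArg (Quotient.mk _) (Subtype.ext ?_)
    simp [c]
  obtain ⟨q, hq, hne⟩ := hV.exists_fixed_point_of_prime_dvd_card_of_fixed_point _ hdvd h1
  obtain ⟨⟨σ, hσ⟩, rfl⟩ := QuotientGroup.mk_surjective q
  refine ⟨σ, hσ, fun h => hne ?_, fun a => ?_⟩
  · rw [QuotientGroup.eq, Subgroup.mem_subgroupOf]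
    simpa using h
  · have := hq (Multiplicative.ofAdd a)
    have h2 : (QuotientGroup.mk (⟨σ, hσ⟩ : N) : N ⧸ A.subgroupOf N) =
      QuotientGroup.mk (c a ⟨σ, hσ⟩) := this.symm
    rw [QuotientGroup.eq, Subgroup.mem_subgroupOf] at h2
    exact h2

end Regular

/-! ## The Heisenberg group: order and centre -/

section HeisenbergCard

/-- Coordinates on the Heisenberg group. -/
def Heisenberg.equivProd (p : ℕ) : Heisenberg p ≃ ZMod p × ZMod p × ZMod p where
  toFun g := (g.x, g.y, g.z)
  invFun t := ⟨t.1, t.2.1, t.2.2⟩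
  left_inv _ := rfl
  right_inv _ := rfl

theorem Heisenberg.card (p : ℕ) : Nat.card (Heisenberg p) = p ^ 3 := by
  rw [Nat.card_congr (Heisenberg.equivProd p)]
  simp [Nat.card_prod, pow_succ, mul_assoc]

theorem Heisenberg.mem_center_iff {p : ℕ} {g : Heisenberg p} :
    g ∈ Subgroup.center (Heisenberg p) ↔ g.x = 0 ∧ g.y = 0 := by
  rw [Subgroup.mem_center_iff]
  constructor
  · intro h
    have h1 := congrArg Heisenberg.z (h ⟨1, 0, 0⟩)
    have h2 := congrArg Heisenberg.z (h ⟨0, 1, 0⟩)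
    simp at h1 h2
    exact ⟨h2, h1⟩
  · rintro ⟨hx, hy⟩ h
    ext <;> simp [hx, hy, add_comm]

theorem Heisenberg.card_center (p : ℕ) : Nat.card (Subgroup.center (Heisenberg p)) = p := by
  let e : Subgroup.center (Heisenberg p) ≃ ZMod p :=
    { toFun := fun g => g.1.z
      invFun := fun t => ⟨⟨0, 0, t⟩, mem_center_iff.2 ⟨rfl, rfl⟩⟩
      left_inv := fun g => by
        obtain ⟨hx, hy⟩ := mem_center_iff.1 g.2
        ext <;> simp [hx, hy]
      right_inv := fun _ => rfl }
  simpa using Nat.card_congr e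

end HeisenbergCard

/-! ## Frames and the explicit family of regular subgroups -/

/-- A basis `e, v, z` of a three-dimensional space together with its dual basis. -/
structure Frame (p : ℕ) (V : Type*) [AddCommGroup V] [Module (ZMod p) V] where
  e : V
  v : V
  z : V
  x₁ : V →ₗ[ZMod p] ZMod p
  x₂ : V →ₗ[ZMod p] ZMod p
  x₃ : V →ₗ[ZMod p] ZMod p
  x₁e : x₁ e = 1
  x₁v : x₁ v = 0
  x₁z : x₁ z = 0
  x₂e : x₂ e = 0
  x₂v : x₂ v = 1
  x₂z : x₂ z = 0
  x₃e : x₃ e = 0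
  x₃v : x₃ v = 0
  x₃z : x₃ z = 1
  decomp : ∀ a, a = x₁ a • e + x₂ a • v + x₃ a • z

attribute [simp] Frame.x₁e Frame.x₁v Frame.x₁z Frame.x₂e Frame.x₂v Frame.x₂z
  Frame.x₃e Frame.x₃v Frame.x₃z

/-- Parameters of the regular subgroups adapted to a frame. -/
@[ext]
structure Param (p : ℕ) where
  g : ZMod p
  P : ZMod p
  Q : ZMod p
  R : ZMod p
  S : ZMod p
  gS : g * S = 0
  ne : P ≠ Q

namespace Frame

variable {p : ℕ} [Fact p.Prime] {V : Type*} [AddCommGroup V] [Module (ZMod p) V]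
  (F : Frame p V) (θ : Param p)

theorem ext_coords {a b : V} (h₁ : F.x₁ a = F.x₁ b) (h₂ : F.x₂ a = F.x₂ b)
    (h₃ : F.x₃ a = F.x₃ b) : a = b := by
  rw [F.decomp a, F.decomp b, h₁, h₂, h₃]

/-- Coordinates with respect to a frame. -/
def equivProd : V ≃ ZMod p × ZMod p × ZMod p where
  toFun a := (F.x₁ a, F.x₂ a, F.x₃ a)
  invFun t := t.1 • F.e + t.2.1 • F.v + t.2.2 • F.z
  left_inv a := (F.decomp a).symm
  right_inv t := by simp

/-- The explicit group law on `V` with the given parameters. -/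
def op (a b : V) : V :=
  a + b + (θ.g * F.x₁ a * F.x₁ b) • F.v +
    (θ.P * F.x₁ a * F.x₂ b + θ.Q * F.x₂ a * F.x₁ b + θ.R * F.x₁ a * F.x₁ b +
      θ.S * F.x₂ a * F.x₂ b +
      θ.g * F.x₁ a * F.x₁ b * (θ.P * F.x₁ a + θ.Q * F.x₁ b) / 2) • F.z

@[simp] theorem x₁_op (a b : V) : F.x₁ (F.op θ a b) = F.x₁ a + F.x₁ b := by simp [op]

@[simp] theorem x₂_op (a b : V) :
    F.x₂ (F.op θ a b) = F.x₂ a + F.x₂ b + θ.g * F.x₁ a * F.x₁ b := by simp [op]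

@[simp] theorem x₃_op (a b : V) :
    F.x₃ (F.op θ a b) = F.x₃ a + F.x₃ b +
      (θ.P * F.x₁ a * F.x₂ b + θ.Q * F.x₂ a * F.x₁ b + θ.R * F.x₁ a * F.x₁ b +
      θ.S * F.x₂ a * F.x₂ b +
      θ.g * F.x₁ a * F.x₁ b * (θ.P * F.x₁ a + θ.Q * F.x₁ b) / 2) := by simp [op]

@[simp] theorem op_zero (a : V) : F.op θ a 0 = a := by simp [op]

@[simp] theorem zero_op (a : V) : F.op θ 0 a = a := by simp [op]

theorem op_assoc (h2 : (2 : ZMod p) ≠ 0) (a b c : V) :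
    F.op θ (F.op θ a b) c = F.op θ a (F.op θ b c) := by
  have hgS := θ.gS
  apply F.ext_coords
  · simp [add_assoc]
  · simp; ring
  · simp
    field_simp
    linear_combination (2 * F.x₁ a * F.x₁ b * F.x₂ c - 2 * F.x₂ a * F.x₁ b * F.x₁ c) * hgS

/-- The left inverse for `Frame.op`. -/
def opInv (a : V) : V :=
  -a + (θ.g * F.x₁ a ^ 2) • F.v +
    (θ.P * F.x₁ a * F.x₂ a + θ.Q * F.x₂ a * F.x₁ a + θ.R * F.x₁ a ^ 2 + θ.S * F.x₂ a ^ 2 -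
      θ.g * F.x₁ a ^ 3 * (θ.P + θ.Q) / 2) • F.z

theorem opInv_op (h2 : (2 : ZMod p) ≠ 0) (a : V) :
    F.op θ (F.opInv θ a) a = 0 := by
  have hgS := θ.gS
  apply F.ext_coords
  · simp [opInv]
  · simp [opInv]; ring
  · simp [opInv]
    field_simp
    linear_combination (2 * F.x₁ a ^ 2 * F.x₂ a) * hgS

theorem op_opInv (h2 : (2 : ZMod p) ≠ 0) (a : V) :
    F.op θ a (F.opInv θ a) = 0 := by
  have hgS := θ.gS
  apply F.ext_coords
  · simp [opInv]
  · simp [opInv]; ring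
  · simp [opInv]
    field_simp
    linear_combination (2 * F.x₁ a ^ 2 * F.x₂ a) * hgS

variable (h2 : (2 : ZMod p) ≠ 0)

/-- Left multiplication by `a` for `Frame.op`, as a permutation. -/
def opPerm (a : V) : Equiv.Perm V where
  toFun := F.op θ a
  invFun := F.op θ (F.opInv θ a)
  left_inv b := by rw [← op_assoc F θ h2, opInv_op F θ h2, zero_op]
  right_inv b := by rw [← op_assoc F θ h2, op_opInv F θ h2, zero_op]

@[simp] theorem opPerm_apply (a b : V) : F.opPerm θ h2 a b = F.op θ a b := rfl

theorem opPerm_mul (a b : V) :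
    F.opPerm θ h2 a * F.opPerm θ h2 b = F.opPerm θ h2 (F.op θ a b) := by
  ext c; simp [op_assoc F θ h2]

/-- The regular subgroup of left multiplications for `Frame.op`. -/
def nsub : Subgroup (Equiv.Perm V) where
  carrier := Set.range (F.opPerm θ h2)
  one_mem' := ⟨0, by ext; simp⟩
  mul_mem' := by
    rintro _ _ ⟨a, rfl⟩ ⟨b, rfl⟩
    exact ⟨_, (F.opPerm_mul θ h2 a b).symm⟩
  inv_mem' := by
    rintro _ ⟨a, rfl⟩
    refine ⟨F.opInv θ a, eq_inv_of_mul_eq_one_left ?_⟩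
    rw [opPerm_mul, opInv_op F θ h2]
    ext; simp

theorem opPerm_mem (a : V) : F.opPerm θ h2 a ∈ F.nsub θ h2 := ⟨a, rfl⟩

theorem nsub_regular : IsRegularSub (F.nsub θ h2) := by
  intro a b
  refine ⟨F.opPerm θ h2 (F.op θ b (F.opInv θ a)), ⟨opPerm_mem .., ?_⟩, ?_⟩
  · simp [op_assoc F θ h2, opInv_op F θ h2]
  · rintro _ ⟨⟨c, rfl⟩, rfl⟩
    congr 1
    simp [op_assoc F θ h2, op_opInv F θ h2]

theorem nsub_normalized : TranslNormalized (F.nsub θ h2) := by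
  rintro a _ ⟨b, rfl⟩
  have hgS := θ.gS
  refine ⟨a + F.op θ b (-a), ?_⟩
  ext y
  simp only [opPerm_apply, Equiv.Perm.mul_apply, transl_apply, transl_inv_apply]
  apply F.ext_coords
  · simp; ring
  · simp; ring
  · simp
    field_simp
    linear_combination (-2 * F.x₁ a * F.x₁ b * F.x₂ y) * hgS

/-- The coordinate isomorphism from `V` with `Frame.op` to the Heisenberg group. -/
def toHeis (a : V) : Heisenberg p where
  x := (θ.P - θ.Q) * (F.x₂ a - θ.g * F.x₁ a ^ 2 / 2)
  y := F.x₁ a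
  z := F.x₃ a - θ.Q * F.x₁ a * F.x₂ a - θ.g * (θ.P / 2 - θ.Q) * F.x₁ a ^ 3 / 3
    - θ.R * F.x₁ a ^ 2 / 2 - θ.S * F.x₂ a ^ 2 / 2

include h2 in
theorem toHeis_op (h3 : (3 : ZMod p) ≠ 0) (a b : V) :
    F.toHeis θ (F.op θ a b) = F.toHeis θ a * F.toHeis θ b := by
  have hgS := θ.gS
  ext
  · simp [toHeis]; field_simp; ring
  · simp [toHeis]
  · simp [toHeis]
    field_simp
    linear_combination (-6 * F.x₁ a * F.x₁ b * (F.x₂ a + F.x₂ b)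
      - 3 * F.x₁ a ^ 2 * F.x₁ b ^ 2 * θ.g) * hgS

theorem toHeis_injective : Function.Injective (F.toHeis θ) := by
  intro a b h
  have h1 : F.x₁ a = F.x₁ b := congrArg Heisenberg.y h
  have h2 := congrArg Heisenberg.x h
  have h3 := congrArg Heisenberg.z h
  simp only [toHeis, h1] at h2 h3
  have h4 : F.x₂ a = F.x₂ b := by
    simpa using mul_left_cancel₀ (sub_ne_zero.2 θ.ne) h2
  rw [h4] at h3
  exact F.ext_coords h1 h4 (by simpa using h3)

theorem toHeis_bijective : Function.Bijective (F.toHeis θ) := by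
  have : Finite V := Finite.of_equiv _ F.equivProd.symm
  have : Finite (Heisenberg p) := Finite.of_equiv _ (Heisenberg.equivProd p).symm
  refine (Nat.bijective_iff_injective_and_card _).2 ⟨F.toHeis_injective θ, ?_⟩
  exact Nat.card_congr (F.equivProd.trans (Heisenberg.equivProd p).symm)

theorem nsub_iso (h3 : (3 : ZMod p) ≠ 0) : Nonempty (F.nsub θ h2 ≃* Heisenberg p) := by
  refine ⟨MulEquiv.ofBijective
    (MonoidHom.mk' (fun σ : F.nsub θ h2 => F.toHeis θ (σ.1 0)) ?_) ⟨?_, ?_⟩⟩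
  · rintro ⟨_, a, rfl⟩ ⟨_, b, rfl⟩
    simp [toHeis_op F θ h2 h3]
  · rintro ⟨_, a, rfl⟩ ⟨_, b, rfl⟩ h
    have : a = b := F.toHeis_injective θ (by simpa using h)
    simp [this]
  · intro h
    obtain ⟨a, rfl⟩ := (F.toHeis_bijective θ).2 h
    exact ⟨⟨_, opPerm_mem F θ h2 a⟩, by simp⟩

end Frame

/-! ## Central translations and flags -/

section Flags

variable {p : ℕ} {V : Type*} [AddCommGroup V]

/-- Regular subgroups isomorphic to the Heisenberg group and normalized by translations. -/
structure IsHeisSub (p : ℕ) (N : Subgroup (Equiv.Perm V)) : Prop where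
  regular : IsRegularSub N
  iso : Nonempty (N ≃* Heisenberg p)
  normalized : TranslNormalized N

/-- Translation by `c` is a central element of `N`. -/
def CentralTransl (N : Subgroup (Equiv.Perm V)) (c : V) : Prop :=
  transl c ∈ N ∧ ∀ τ ∈ N, ∀ y, τ (y + c) = τ y + c

/-- Every element of `N` is a translation up to central translations. -/
def IsFlat (N : Subgroup (Equiv.Perm V)) : Prop :=
  ∀ σ ∈ N, ∀ b, CentralTransl N (σ b - b - σ 0)

/-- The elements of `N` commuting with all of `N`, as permutations. -/
def centerIn (N : Subgroup (Equiv.Perm V)) : Subgroup (Equiv.Perm V) :=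
  (Subgroup.center N).map N.subtype

theorem mem_centerIn {N : Subgroup (Equiv.Perm V)} {σ : Equiv.Perm V} :
    σ ∈ centerIn N ↔ σ ∈ N ∧ ∀ τ ∈ N, τ * σ = σ * τ := by
  simp only [centerIn, Subgroup.mem_map, Subgroup.mem_center_iff, Subtype.exists, Subtype.forall,
    Subgroup.subtype_apply, Subtype.ext_iff, Subgroup.coe_mul, exists_prop]
  constructor
  · rintro ⟨τ, hτ, h, rfl⟩
    exact ⟨hτ, h⟩
  · rintro ⟨hσ, h⟩
    exact ⟨σ, hσ, h, rfl⟩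

theorem transl_neg (a : V) : transl (-a) = (transl a)⁻¹ := by
  ext b; simp [sub_eq_neg_add]

theorem TranslNormalized.inv_mul_mul_mem {N : Subgroup (Equiv.Perm V)} (hN : TranslNormalized N)
    (a : V) {σ : Equiv.Perm V} (hσ : σ ∈ N) : (transl a)⁻¹ * σ * transl a ∈ N := by
  simpa [transl_neg] using hN (-a) σ hσ

theorem TranslNormalized.centerIn {N : Subgroup (Equiv.Perm V)} (hN : TranslNormalized N) :
    TranslNormalized (centerIn N) := by
  intro a σ hσ
  rw [mem_centerIn] at hσ ⊢
  refine ⟨hN a σ hσ.1, fun τ hτ => ?_⟩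
  have h := hσ.2 _ (hN.inv_mul_mul_mem a hτ)
  calc τ * (transl a * σ * (transl a)⁻¹)
      = transl a * ((transl a)⁻¹ * τ * transl a * σ) * (transl a)⁻¹ := by group
    _ = transl a * σ * (transl a)⁻¹ * τ := by rw [h]; group

theorem IsHeisSub.card_centerIn {N : Subgroup (Equiv.Perm V)} (hN : IsHeisSub p N) :
    Nat.card (centerIn N) = p := by
  obtain ⟨e⟩ := hN.iso
  rw [centerIn, Subgroup.card_map_of_injective N.subtype_injective,
    Nat.card_congr (Subgroup.centerCongr e).toEquiv, Heisenberg.card_center]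

theorem IsHeisSub.card {N : Subgroup (Equiv.Perm V)} (hN : IsHeisSub p N) :
    Nat.card N = p ^ 3 := by
  obtain ⟨e⟩ := hN.iso
  rw [Nat.card_congr e.toEquiv, Heisenberg.card]

theorem IsHeisSub.commutator_mem {N : Subgroup (Equiv.Perm V)} (hN : IsHeisSub p N)
    {σ τ : Equiv.Perm V} (hσ : σ ∈ N) (hτ : τ ∈ N) : σ * τ * σ⁻¹ * τ⁻¹ ∈ centerIn N := by
  obtain ⟨e⟩ := hN.iso
  let s : N := ⟨σ, hσ⟩
  let t : N := ⟨τ, hτ⟩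
  have h : e (s * t * s⁻¹ * t⁻¹) ∈ Subgroup.center (Heisenberg p) := by
    rw [Heisenberg.mem_center_iff]
    simp
  refine ⟨s * t * s⁻¹ * t⁻¹, ?_, rfl⟩
  change s * t * s⁻¹ * t⁻¹ ∈ Subgroup.center N
  rw [Subgroup.mem_center_iff] at h ⊢
  intro x
  apply e.injective
  simpa only [map_mul] using h (e x)

theorem transl_zpow (z : V) (k : ℤ) : transl z ^ k = transl (k • z) := by
  let f : Multiplicative V →* Equiv.Perm V :=
    MonoidHom.mk' (fun a => transl a.toAdd) fun a b => transl_add _ _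
  exact (map_zpow f (Multiplicative.ofAdd z) k).symm

variable [Fact p.Prime] [Module (ZMod p) V]

theorem transl_smul_mem {N : Subgroup (Equiv.Perm V)} {z : V} (hz : transl z ∈ N) (t : ZMod p) :
    transl (t • z) ∈ N := by
  have : t • z = (t.val : ℤ) • z := by
    rw [← Int.cast_smul_eq_zsmul (ZMod p)]
    simp
  rw [this, ← transl_zpow]
  exact zpow_mem hz _

theorem CentralTransl.mem_centerIn {N : Subgroup (Equiv.Perm V)} {z : V}
    (hz : CentralTransl N z) : transl z ∈ centerIn N := by
  refine _root_.mem_centerIn.2 ⟨hz.1, fun τ hτ => ?_⟩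
  ext y
  simp [add_comm z, hz.2 τ hτ]

theorem IsHeisSub.eq_transl_smul {N : Subgroup (Equiv.Perm V)} (hN : IsHeisSub p N) {z : V}
    (hz : CentralTransl N z) (hz0 : z ≠ 0) {σ : Equiv.Perm V} (hσ : σ ∈ centerIn N) :
    ∃ t : ZMod p, σ = transl (t • z) := by
  have hne : (⟨transl z, hz.mem_centerIn⟩ : centerIn N) ≠ 1 := by
    intro h
    have := congrArg (fun s : centerIn N => s.1 0) h
    simp [hz0] at this
  obtain ⟨k, hk⟩ := mem_zpowers_of_prime_card hN.card_centerIn (g' := ⟨σ, hσ⟩) hne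
  refine ⟨k, ?_⟩
  rw [Int.cast_smul_eq_zsmul, ← transl_zpow]
  exact (congrArg Subtype.val hk).symm

theorem IsHeisSub.exists_centralTransl {N : Subgroup (Equiv.Perm V)} (hN : IsHeisSub p N)
    (hV : Nat.card V = p ^ 3) : ∃ z, z ≠ 0 ∧ CentralTransl N z := by
  have : Finite V := Nat.finite_of_card_ne_zero (by
    rw [hV]; exact pow_ne_zero _ (NeZero.ne p))
  have hG : IsPGroup p (Multiplicative V) := IsPGroup.of_card (n := 3) hV
  have hbot : TranslNormalized (⊥ : Subgroup (Equiv.Perm V)) := by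
    rintro a σ hσ
    rw [Subgroup.mem_bot] at hσ ⊢
    simp [hσ]
  obtain ⟨σ, hσ, hσ1, h⟩ := exists_fixed_coset hG hbot hN.normalized.centerIn
    (by rw [Subgroup.relIndex_bot_left, hN.card_centerIn])
  have hσt : σ = transl (σ 0) := by
    ext b
    have h2 := h b
    rw [Subgroup.mem_bot, inv_mul_eq_one] at h2
    have h3 := congrArg (fun s : Equiv.Perm V => s b) h2
    simp at h3
    rw [h3, transl_apply, add_comm]
  have hσ' := mem_centerIn.1 hσ
  refine ⟨σ 0, fun h0 => hσ1 ?_, hσt ▸ hσ'.1, fun τ hτ y => ?_⟩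
  · rw [Subgroup.mem_bot, hσt, h0, transl_zero]
  · have := congrArg (fun s : Equiv.Perm V => s y) (hσ'.2 τ hτ)
    rw [hσt] at this
    simpa [add_comm] using this

/-- A pair `z, v` such that `z` spans the central translations of `N` and `v` is, modulo `z`, a
translation in `N`. -/
structure IsFlag (p : ℕ) [Module (ZMod p) V] (N : Subgroup (Equiv.Perm V)) (z v : V) : Prop where
  central : CentralTransl N z
  indep : LinearIndependent (ZMod p) ![z, v]
  lift : ∃ n ∈ N, n 0 = v ∧ ∀ b, ∃ t : ZMod p, n b = b + v + t • z

theorem IsHeisSub.exists_isFlag {N : Subgroup (Equiv.Perm V)} (hN : IsHeisSub p N)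
    (hV : Nat.card V = p ^ 3) : ∃ z v, IsFlag p N z v := by
  obtain ⟨z, hz0, hz⟩ := hN.exists_centralTransl hV
  have : Finite V := Nat.finite_of_card_ne_zero (by
    rw [hV]; exact pow_ne_zero _ (NeZero.ne p))
  have hG : IsPGroup p (Multiplicative V) := IsPGroup.of_card (n := 3) hV
  have hle : centerIn N ≤ N := fun σ hσ => (mem_centerIn.1 hσ).1
  have hdvd : p ∣ (centerIn N).relIndex N := by
    have h1 := Subgroup.card_mul_index ((centerIn N).subgroupOf N)
    rw [Nat.card_congr (Subgroup.subgroupOfEquivOfLe hle).toEquiv, hN.card_centerIn, hN.card,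
      pow_succ', pow_two] at h1
    exact ⟨p, Nat.eq_of_mul_eq_mul_left (NeZero.pos p) h1⟩
  obtain ⟨σ, hσ, hσ1, h⟩ := exists_fixed_coset hG hN.normalized.centerIn hN.normalized hdvd
  have hb (b : V) : ∃ t : ZMod p, σ b = b + σ 0 + t • z := by
    obtain ⟨t, ht⟩ := hN.eq_transl_smul hz hz0 (h b)
    rw [inv_mul_eq_iff_eq_mul] at ht
    have hc := (mem_centerIn.1 (h b)).2 σ hσ
    rw [inv_mul_eq_iff_eq_mul.2 ht] at hc
    rw [hc] at ht
    have h3 := congrArg (fun s : Equiv.Perm V => s b) ht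
    simp at h3
    refine ⟨-t, ?_⟩
    rw [h3, neg_smul]
    abel
  refine ⟨z, σ 0, hz, ?_, σ, hσ, rfl, hb⟩
  rw [LinearIndependent.pair_iff' hz0]
  intro t ht
  apply hσ1
  have : σ = transl (t • z) :=
    hN.regular.eq_of_apply_eq (x := 0) hσ (transl_smul_mem hz.1 t) (by simp [ht])
  rw [this]
  exact transl_smul_mem hz.mem_centerIn t

end Flags

/-! ## The explicit subgroups: parameters, flatness and flags -/

namespace Frame

variable {p : ℕ} [Fact p.Prime] {V : Type*} [AddCommGroup V] [Module (ZMod p) V]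
  (F : Frame p V) (θ : Param p) (h2 : (2 : ZMod p) ≠ 0)

theorem nsub_isHeisSub (h3 : (3 : ZMod p) ≠ 0) : IsHeisSub p (F.nsub θ h2) :=
  ⟨F.nsub_regular θ h2, F.nsub_iso θ h2 h3, F.nsub_normalized θ h2⟩

theorem eq_opPerm_of_mem {σ : Equiv.Perm V} (hσ : σ ∈ F.nsub θ h2) :
    σ = F.opPerm θ h2 (σ 0) := by
  obtain ⟨a, rfl⟩ := hσ
  simp

theorem nsub_injective : Function.Injective fun θ => F.nsub θ h2 := by
  intro θ θ' h
  have key (a b : V) : F.op θ a b = F.op θ' a b := by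
    have hm : F.opPerm θ h2 a ∈ F.nsub θ' h2 := by
      rw [← show F.nsub θ h2 = F.nsub θ' h2 from h]
      exact F.opPerm_mem θ h2 a
    have := congrArg (fun s : Equiv.Perm V => s b) (F.eq_opPerm_of_mem θ' h2 hm)
    simpa using this
  have hg : θ.g = θ'.g := by simpa using congrArg F.x₂ (key F.e F.e)
  have hP : θ.P = θ'.P := by simpa using congrArg F.x₃ (key F.e F.v)
  have hQ : θ.Q = θ'.Q := by simpa using congrArg F.x₃ (key F.v F.e)
  have hS : θ.S = θ'.S := by simpa using congrArg F.x₃ (key F.v F.v)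
  have hR : θ.R = θ'.R := by simpa [hg, hP, hQ] using congrArg F.x₃ (key F.e F.e)
  exact Param.ext hg hP hQ hR hS

theorem centralTransl_nsub_iff (c : V) :
    CentralTransl (F.nsub θ h2) c ↔ F.x₁ c = 0 ∧ F.x₂ c = 0 := by
  constructor
  · rintro ⟨hc, hc'⟩
    have h (a : V) : F.op θ c a = c + a := by
      have := congrArg (fun s : Equiv.Perm V => s a) (F.eq_opPerm_of_mem θ h2 hc)
      simpa using this.symm
    have h' (a : V) : F.op θ a c = a + c := by
      simpa using hc' _ (F.opPerm_mem θ h2 a) 0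
    have hcv : θ.P * F.x₁ c + θ.S * F.x₂ c = 0 := by simpa using congrArg F.x₃ (h F.v)
    have hvc : θ.Q * F.x₁ c + θ.S * F.x₂ c = 0 := by simpa using congrArg F.x₃ (h' F.v)
    have h1 : F.x₁ c = 0 := by
      have : (θ.P - θ.Q) * F.x₁ c = 0 := by linear_combination hcv - hvc
      exact (mul_eq_zero.1 this).resolve_left (sub_ne_zero.2 θ.ne)
    have hce : θ.Q * F.x₂ c = 0 := by simpa [h1] using congrArg F.x₃ (h F.e)
    have hec : θ.P * F.x₂ c = 0 := by simpa [h1] using congrArg F.x₃ (h' F.e)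
    refine ⟨h1, ?_⟩
    have : (θ.P - θ.Q) * F.x₂ c = 0 := by linear_combination hec - hce
    exact (mul_eq_zero.1 this).resolve_left (sub_ne_zero.2 θ.ne)
  · rintro ⟨h1, h2c⟩
    have : transl c = F.opPerm θ h2 c := by
      ext a; simp [op, h1, h2c]
    refine ⟨this ▸ F.opPerm_mem θ h2 c, ?_⟩
    rintro _ ⟨a, rfl⟩ y
    apply F.ext_coords
    · simp [h1]
    · simp [h1, h2c]
    · simp [h1, h2c]; ring

theorem isFlat_nsub_iff : IsFlat (F.nsub θ h2) ↔ θ.g = 0 := by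
  constructor
  · intro h
    have := h _ (F.opPerm_mem θ h2 F.e) F.e
    rw [centralTransl_nsub_iff] at this
    simpa using this.2
  · rintro hg _ ⟨a, rfl⟩ b
    rw [centralTransl_nsub_iff]
    simp [hg]

theorem isFlag_nsub_iff (z v : V) :
    IsFlag p (F.nsub θ h2) z v ↔
      (F.x₁ z = 0 ∧ F.x₂ z = 0 ∧ F.x₃ z ≠ 0) ∧
      θ.g * F.x₁ v = 0 ∧ ¬(F.x₁ v = 0 ∧ F.x₂ v = 0) := by
  constructor
  · rintro ⟨hz, hi, n, hn, hn0, hb⟩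
    rw [centralTransl_nsub_iff] at hz
    have hz0 : F.x₃ z ≠ 0 := by
      intro h
      apply hi.ne_zero 0
      apply F.ext_coords <;> simp [hz, h]
    refine ⟨⟨hz.1, hz.2, hz0⟩, ?_, ?_⟩
    · obtain ⟨t, ht⟩ := hb F.e
      rw [F.eq_opPerm_of_mem θ h2 hn, hn0] at ht
      simpa [hz] using congrArg F.x₂ ht
    · rintro ⟨h1, h2'⟩
      rw [LinearIndependent.pair_iff] at hi
      have := hi (F.x₃ v) (-F.x₃ z) (by apply F.ext_coords <;> simp [hz, h1, h2', mul_comm])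
      exact hz0 (by simpa using this.2)
  · rintro ⟨⟨h1, h2', h3⟩, hg, hv⟩
    refine ⟨(F.centralTransl_nsub_iff θ h2 z).2 ⟨h1, h2'⟩, ?_, _, F.opPerm_mem θ h2 v, ?_, ?_⟩
    · rw [LinearIndependent.pair_iff]
      intro s t hst
      have e1 : t * F.x₁ v = 0 := by simpa [h1] using congrArg F.x₁ hst
      have e2 : t * F.x₂ v = 0 := by simpa [h2'] using congrArg F.x₂ hst
      have ht : t = 0 := by
        by_contra ht
        exact hv ⟨(mul_eq_zero.1 e1).resolve_left ht, (mul_eq_zero.1 e2).resolve_left ht⟩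
      have e3 : s * F.x₃ z = 0 := by simpa [ht] using congrArg F.x₃ hst
      exact ⟨(mul_eq_zero.1 e3).resolve_right h3, ht⟩
    · simp
    · intro b
      refine ⟨(F.x₃ (F.op θ v b) - F.x₃ v - F.x₃ b) / F.x₃ z, ?_⟩
      apply F.ext_coords
      · simp [h1, add_comm]
      · simp [h2', hg, add_comm]
      · rw [opPerm_apply, map_add, map_smul, smul_eq_mul, div_mul_cancel₀ _ h3, map_add]
        ring

/-! ## Classification -/

theorem linear_of_additive {f : V → ZMod p} (hf : ∀ a b, f (a + b) = f a + f b) (b : V) :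
    f b = F.x₁ b * f F.e + F.x₂ b * f F.v + F.x₃ b * f F.z := by
  let l : V →ₗ[ZMod p] ZMod p := (AddMonoidHom.mk' f hf).toZModLinearMap p
  have h : l b = l (F.x₁ b • F.e + F.x₂ b • F.v + F.x₃ b • F.z) := congrArg l (F.decomp b)
  simp only [map_add, map_smul, smul_eq_mul] at h
  exact h

/-- Powers of a unipotent affine map, combined with translations along `z`. -/
theorem exists_mem_shift {H : Subgroup (Equiv.Perm V)} (hz : transl F.z ∈ H)
    {n : Equiv.Perm V} (hn : n ∈ H) {c₁ c₂ : ZMod p}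
    (hnb : ∀ b, n b = b + F.v + (c₁ * F.x₁ b + c₂ * F.x₂ b) • F.z) (k s : ZMod p)
    (h2 : (2 : ZMod p) ≠ 0) :
    ∃ u ∈ H, ∀ b, u b = b + k • F.v +
      (k * (c₁ * F.x₁ b + c₂ * F.x₂ b) + k * (k - 1) / 2 * c₂ + s) • F.z := by
  have hpow (i : ℕ) (b : V) : (n ^ i) b = b + (i : ZMod p) • F.v +
      (i * (c₁ * F.x₁ b + c₂ * F.x₂ b) + i * (i - 1) / 2 * c₂) • F.z := by
    induction i with
    | zero => simp
    | succ i ih =>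
      rw [pow_succ', Equiv.Perm.mul_apply, ih, hnb]
      apply F.ext_coords
      · simp
      · simp; ring
      · simp; field_simp; ring
  refine ⟨transl (s • F.z) * n ^ k.val, mul_mem (transl_smul_mem hz s) (pow_mem hn _), ?_⟩
  intro b
  rw [Equiv.Perm.mul_apply, hpow, transl_apply, ZMod.natCast_zmod_val]
  module

theorem exists_mem_apply_eq {H : Subgroup (Equiv.Perm V)} (hz : transl F.z ∈ H)
    {n : Equiv.Perm V} (hn : n ∈ H) {c₁ c₂ : ZMod p}
    (hnb : ∀ b, n b = b + F.v + (c₁ * F.x₁ b + c₂ * F.x₂ b) • F.z)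
    (h2 : (2 : ZMod p) ≠ 0) {m : Equiv.Perm V} (hm : m ∈ H) {r : ZMod p} (hr : r ≠ 0)
    (hmb : ∀ b, F.x₁ (m b) = F.x₁ b + r) (y : V) :
    ∃ u ∈ H, u 0 = y ∧ ∀ b, F.x₁ (u b) = F.x₁ b + F.x₁ y := by
  have hpow (i : ℕ) (b : V) : F.x₁ ((m ^ i) b) = F.x₁ b + i * r := by
    induction i with
    | zero => simp
    | succ i ih =>
      rw [pow_succ', Equiv.Perm.mul_apply, hmb, ih]
      push_cast; ring
  let i : ℕ := (F.x₁ y / r).val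
  have hi (b : V) : F.x₁ ((m ^ i) b) = F.x₁ b + F.x₁ y := by
    rw [hpow, ZMod.natCast_zmod_val, div_mul_cancel₀ _ hr]
  let a := (m ^ i) 0
  have ha : F.x₁ a = F.x₁ y := by simpa using hi 0
  let k := F.x₂ y - F.x₂ a
  obtain ⟨u, hu, hub⟩ := F.exists_mem_shift hz hn hnb k
    (F.x₃ y - F.x₃ a - (k * (c₁ * F.x₁ a + c₂ * F.x₂ a) + k * (k - 1) / 2 * c₂)) h2
  refine ⟨u * m ^ i, mul_mem hu (pow_mem hm _), ?_, fun b => ?_⟩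
  · rw [Equiv.Perm.mul_apply]
    change u a = y
    rw [hub]
    apply F.ext_coords
    · simp [ha]
    · simp [k]
    · simp
  · rw [Equiv.Perm.mul_apply, hub]
    simp [hi]

variable {N : Subgroup (Equiv.Perm V)}

theorem exists_affine_lift (hN : IsHeisSub p N) (hflag : IsFlag p N F.z F.v) :
    ∃ n ∈ N, ∃ c₁ c₂ : ZMod p,
      ∀ b, n b = b + F.v + (c₁ * F.x₁ b + c₂ * F.x₂ b) • F.z := by
  obtain ⟨n, hn, hn0, hnb⟩ := hflag.lift
  choose c hc using hnb
  have hc0 : c 0 = 0 := by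
    have := congrArg F.x₃ (hc 0)
    simpa [hn0] using this.symm
  have hcz : c F.z = 0 := by
    have h1 := hflag.central.2 n hn 0
    rw [zero_add, hn0, hc] at h1
    simpa using congrArg F.x₃ h1
  have hadd (a b : V) : c (a + b) = c a + c b := by
    have h1 := hN.normalized.inv_mul_mul_mem a hn
    have h2 := mul_mem (transl_smul_mem hflag.central.1 (c a)) hn
    have h3 := hN.regular.eq_of_apply_eq h1 h2 (x := 0) (by
      simp only [Equiv.Perm.mul_apply, transl_apply, transl_inv_apply, hc, add_zero, hc0]
      module)
    have h4 := congrArg (fun s : Equiv.Perm V => F.x₃ (s b)) h3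
    simp only [Equiv.Perm.mul_apply, transl_apply, transl_inv_apply, hc] at h4
    simp at h4
    linear_combination h4
  refine ⟨n, hn, c F.e, c F.v, fun b => ?_⟩
  rw [hc, F.linear_of_additive hadd b, hcz]
  ring_nf

theorem _root_.perm_apply_inv_apply {X : Type*} (σ : Equiv.Perm X) (b : X) : σ (σ⁻¹ b) = b :=
  σ.apply_symm_apply b

/-- Some element of `N` acts on the first coordinate as a nontrivial translation. -/
theorem exists_shift_fst (hN : IsHeisSub p N) : ∃ m ∈ N, ∃ r : ZMod p, r ≠ 0 ∧
    ∀ b, F.x₁ (m b) = F.x₁ b + r := by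
  have hV : Nat.card V = p ^ 3 := by
    rw [Nat.card_congr F.equivProd]
    simp [pow_succ, mul_assoc]
  have : Finite V := Nat.finite_of_card_ne_zero (by
    rw [hV]; exact pow_ne_zero _ (NeZero.ne p))
  have hG : IsPGroup p (Multiplicative V) := IsPGroup.of_card (n := 3) hV
  let A : Subgroup (Equiv.Perm V) :=
    { carrier := {σ | σ ∈ N ∧ ∀ b, F.x₁ (σ b) = F.x₁ b}
      one_mem' := ⟨one_mem N, fun b => rfl⟩
      mul_mem' := fun {σ τ} hσ hτ => ⟨mul_mem hσ.1 hτ.1, fun b => by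
        rw [Equiv.Perm.mul_apply, hσ.2, hτ.2]⟩
      inv_mem' := fun {σ} hσ => ⟨inv_mem hσ.1, fun b => by
        rw [← hσ.2, perm_apply_inv_apply]⟩ }
  have hA : TranslNormalized A := fun a σ hσ => ⟨hN.normalized a σ hσ.1, fun b => by
    simp [hσ.2]⟩
  have hdvd : p ∣ A.relIndex N := by
    have h1 : A.relIndex N ∣ p ^ 3 := hN.card ▸ Subgroup.relIndex_dvd_card A N
    obtain ⟨k, -, hk⟩ := (Nat.dvd_prime_pow (Fact.out : p.Prime)).1 h1
    rw [hk]
    refine dvd_pow_self p fun h0 => ?_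
    rw [h0, pow_zero, Subgroup.relIndex_eq_one] at hk
    obtain ⟨σ, hσ, hσe⟩ := hN.regular.exists_apply_eq 0 F.e
    have := (hk hσ).2 0
    simp [hσe] at this
  obtain ⟨σ, hσ, hσA, h⟩ := exists_fixed_coset hG hA hN.normalized hdvd
  have hshift (a : V) : F.x₁ (σ⁻¹ a) = F.x₁ a + F.x₁ (σ⁻¹ 0) := by
    have h1 := (h a).2 (a + σ⁻¹ 0)
    simp only [Equiv.Perm.mul_apply, transl_apply, transl_inv_apply, add_sub_cancel_left,
      perm_apply_inv_apply, add_zero,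
      map_add] at h1
    exact h1
  refine ⟨σ⁻¹, inv_mem hσ, F.x₁ (σ⁻¹ 0), fun h0 => hσA ?_, hshift⟩
  rw [← inv_mem_iff]
  exact ⟨inv_mem hσ, fun b => by rw [hshift, h0, add_zero]⟩

end Frame

namespace Frame

variable {p : ℕ} [Fact p.Prime] {V : Type*} [AddCommGroup V] [Module (ZMod p) V]
  (F : Frame p V) (h2 : (2 : ZMod p) ≠ 0) {N : Subgroup (Equiv.Perm V)}

/-- The element of `N` sending `0` to `e`, in terms of the coefficients of the element sending `0`
to `v`. -/
theorem exists_quadratic_lift (hN : IsHeisSub p N) (hz : CentralTransl N F.z)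
    {n : Equiv.Perm V} (hn : n ∈ N) {c₁ c₂ : ZMod p}
    (hnb : ∀ b, n b = b + F.v + (c₁ * F.x₁ b + c₂ * F.x₂ b) • F.z)
    (h2 : (2 : ZMod p) ≠ 0) :
    ∃ m ∈ N, ∃ g h₁ h₂ : ZMod p, g * c₂ = 0 ∧ ∀ b, m b = b + F.e + (g * F.x₁ b) • F.v +
      (g * c₁ / 2 * F.x₁ b ^ 2 + h₁ * F.x₁ b + h₂ * F.x₂ b) • F.z := by
  obtain ⟨m₀, hm₀, r, hr, hmr⟩ := F.exists_shift_fst hN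
  obtain ⟨m, hm, hm0, hm1⟩ := F.exists_mem_apply_eq hz.1 hn hnb h2 hm₀ hr hmr F.e
  rw [F.x₁e] at hm1
  let k (b : V) : ZMod p := F.x₂ (m b) - F.x₂ b
  let j (b : V) : ZMod p := F.x₃ (m b) - F.x₃ b
  have hmb (b : V) : m b = b + F.e + k b • F.v + j b • F.z := by
    apply F.ext_coords
    · simp [hm1]
    · simp [k]
    · simp [j]
  have hmz (b : V) : m (b + F.z) = m b + F.z := hz.2 m hm b
  have key (a b : V) : k (a + b) = k b + k a ∧
      j (a + b) = j b + j a + k a * (c₁ * F.x₁ b + c₂ * (F.x₂ b + k b)) := by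
    obtain ⟨u, hu, hub⟩ := F.exists_mem_shift hz.1 hn hnb (k a)
      (j a - (k a * c₁ + k a * (k a - 1) / 2 * c₂)) h2
    have h1 := hN.regular.eq_of_apply_eq (hN.normalized.inv_mul_mul_mem a hm) (mul_mem hu hm)
      (x := 0) (by
        simp only [Equiv.Perm.mul_apply, transl_apply, transl_inv_apply, hm0, hub, add_zero]
        rw [hmb a]
        apply F.ext_coords <;> simp)
    have h3 := congrArg (fun s : Equiv.Perm V => s b) h1
    simp only [Equiv.Perm.mul_apply, transl_apply, transl_inv_apply, hub] at h3
    have e2 := congrArg F.x₂ h3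
    have e3 := congrArg F.x₃ h3
    simp only [hmb, map_add, map_sub, map_smul, smul_eq_mul, x₁e, x₁v, x₁z, x₂e, x₂v, x₂z, x₃e,
      x₃v, x₃z] at e2 e3
    constructor
    · linear_combination e2
    · linear_combination e3
  have hkz : k F.z = 0 := by
    have := congrArg F.x₂ (hmz 0)
    simp only [zero_add, hm0, map_add, x₂e, x₂z] at this
    simp [k, this]
  have hjz : j F.z = 0 := by
    have := congrArg F.x₃ (hmz 0)
    simp only [zero_add, hm0, map_add, x₃e, x₃z] at this
    simp [j, this]
  have hz0 : F.z ≠ 0 := fun h => by simpa [h] using F.x₃z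
  have hkv : k F.v = 0 := by
    obtain ⟨t, ht⟩ := hN.eq_transl_smul hz hz0 (hN.commutator_mem hm hn)
    rw [mul_inv_eq_iff_eq_mul, mul_inv_eq_iff_eq_mul] at ht
    have h3 := congrArg (fun s : Equiv.Perm V => F.x₂ (s 0)) ht
    simp only [Equiv.Perm.mul_apply, hm0, hnb, transl_apply] at h3
    simp at h3
    simp [k, h3]
  have hk (b : V) : k b = k F.e * F.x₁ b := by
    rw [F.linear_of_additive (f := k) (fun a b => by rw [(key a b).1, add_comm]) b, hkz, hkv]
    ring
  have hgc : k F.e * c₂ = 0 := by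
    have e1 := (key F.e F.v).2
    have e2 := (key F.v F.e).2
    rw [add_comm F.v F.e] at e2
    simp [hkv] at e1 e2
    have := e1.symm.trans e2
    rw [add_comm (j F.e), add_eq_left] at this
    simpa using this
  let q (b : V) : ZMod p := j b - k F.e * c₁ / 2 * F.x₁ b ^ 2
  have hq (b : V) : q b = F.x₁ b * q F.e + F.x₂ b * q F.v + F.x₃ b * q F.z := by
    refine F.linear_of_additive (fun a b => ?_) b
    simp only [q, (key a b).2, hk a, hk b, map_add]
    field_simp
    linear_combination (2 * F.x₁ a * (F.x₂ b + k F.e * F.x₁ b)) * hgc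
  refine ⟨m, hm, k F.e, q F.e, q F.v, hgc, fun b => ?_⟩
  have hqz : q F.z = 0 := by simp [q, hjz]
  have hj : j b = k F.e * c₁ / 2 * F.x₁ b ^ 2 + q F.e * F.x₁ b + q F.v * F.x₂ b := by
    have := hq b
    rw [hqz] at this
    linear_combination this
  rw [hmb, hk b, hj]

/-- A regular subgroup with a flag adapted to the frame is one of the explicit subgroups. -/
theorem exists_eq_nsub (hN : IsHeisSub p N) (hflag : IsFlag p N F.z F.v) :
    ∃ θ, F.nsub θ h2 = N := by
  have hz := hflag.central
  have hz0 : F.z ≠ 0 := fun h => by simpa [h] using F.x₃z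
  obtain ⟨n, hn, c₁, c₂, hnb⟩ := F.exists_affine_lift hN hflag
  obtain ⟨m, hm, g, h₁, h₂, hgc, hmb⟩ := F.exists_quadratic_lift hN hz hn hnb h2
  have hm1 (b : V) : F.x₁ (m b) = F.x₁ b + 1 := by simp [hmb]
  have hne : h₂ ≠ c₁ := by
    rintro rfl
    have hcomm : m * n = n * m := by
      ext b
      simp only [Equiv.Perm.mul_apply, hmb, hnb]
      apply F.ext_coords
      · simp
      · simp; ring
      · simp; linear_combination (-F.x₁ b) * hgc
    have hle : N ≤ N ⊓ Subgroup.centralizer {n} := by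
      refine hN.regular.le_of_transitive inf_le_left 0 fun y => ?_
      have hzc : transl F.z * n = n * transl F.z := by
        ext b
        simp [add_comm F.z, hz.2 n hn]
      obtain ⟨u, hu, hu0, -⟩ := F.exists_mem_apply_eq (H := N ⊓ Subgroup.centralizer {n})
        ⟨hz.1, Subgroup.mem_centralizer_singleton_iff.2 hzc⟩
        ⟨hn, Subgroup.mem_centralizer_singleton_iff.2 rfl⟩ hnb h2
        ⟨hm, Subgroup.mem_centralizer_singleton_iff.2 hcomm⟩ one_ne_zero hm1 y
      exact ⟨u, hu, hu0⟩
    have hnc : n ∈ centerIn N := mem_centerIn.2 ⟨hn, fun τ hτ =>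
      Subgroup.mem_centralizer_singleton_iff.1 (hle hτ).2⟩
    obtain ⟨t, ht⟩ := hN.eq_transl_smul hz hz0 hnc
    have := congrArg (fun s : Equiv.Perm V => F.x₂ (s 0)) ht
    simp [hnb] at this
  let θ : Param p := ⟨g, h₂, c₁, h₁ - g * h₂ / 2, c₂, hgc, hne⟩
  refine ⟨θ, ?_⟩
  have hmθ : F.opPerm θ h2 F.e = m := by
    ext b
    rw [opPerm_apply, hmb]
    apply F.ext_coords
    · simp [add_comm]
    · simp [add_comm, θ]
    · simp [θ]; field_simp; ring
  have hnθ : F.opPerm θ h2 F.v = n := by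
    ext b
    rw [opPerm_apply, hnb]
    apply F.ext_coords
    · simp
    · simp [add_comm]
    · simp [θ]
  have hzθ : transl F.z ∈ F.nsub θ h2 :=
    ((F.centralTransl_nsub_iff θ h2 F.z).2 ⟨F.x₁z, F.x₂z⟩).1
  have htrans (y : V) : ∃ u ∈ N ⊓ F.nsub θ h2, u 0 = y := by
    obtain ⟨u, hu, hu0, -⟩ := F.exists_mem_apply_eq (H := N ⊓ F.nsub θ h2)
      ⟨hz.1, hzθ⟩ ⟨hn, hnθ ▸ F.opPerm_mem θ h2 F.v⟩ hnb h2
      ⟨hm, hmθ ▸ F.opPerm_mem θ h2 F.e⟩ one_ne_zero hm1 y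
    exact ⟨u, hu, hu0⟩
  apply le_antisymm
  · exact ((F.nsub_regular θ h2).le_of_transitive inf_le_right 0 htrans).trans inf_le_left
  · exact (hN.regular.le_of_transitive inf_le_left 0 htrans).trans inf_le_right

end Frame

/-! ## Counting -/

theorem Nat.card_mul_eq_card_mul_of_relation {α β : Type*} [Finite α] [Finite β]
    (r : α → β → Prop) {m n : ℕ} (hm : ∀ a, Nat.card {b // r a b} = m)
    (hn : ∀ b, Nat.card {a // r a b} = n) : Nat.card α * m = Nat.card β * n := by
  classical
  have := Fintype.ofFinite α
  have := Fintype.ofFinite β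
  rw [Nat.card_eq_fintype_card, Nat.card_eq_fintype_card]
  refine Finset.card_mul_eq_card_mul r (s := Finset.univ) (t := Finset.univ)
    (fun a _ => ?_) (fun b _ => ?_)
  · rw [← hm a, Nat.card_eq_fintype_card, Fintype.card_subtype]
    rfl
  · rw [← hn b, Nat.card_eq_fintype_card, Fintype.card_subtype]
    rfl

namespace Param

variable {p : ℕ} [Fact p.Prime]

theorem card_g_eq_zero : Nat.card {θ : Param p // θ.g = 0} = p * ((p - 1) * (p * p)) := by
  let f : {θ : Param p // θ.g = 0} ≃ ZMod p × {d : ZMod p // d ≠ 0} × ZMod p × ZMod p :=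
    { toFun θ := (θ.1.Q, ⟨θ.1.P - θ.1.Q, sub_ne_zero.2 θ.1.ne⟩, θ.1.R, θ.1.S)
      invFun t := ⟨⟨0, t.1 + t.2.1, t.1, t.2.2.1, t.2.2.2, zero_mul _, by simpa using t.2.1.2⟩,
        rfl⟩
      left_inv θ := by ext <;> simp [θ.2]
      right_inv t := by simp }
  simp [Nat.card_congr f]

theorem card_g_ne_zero :
    Nat.card {θ : Param p // θ.g ≠ 0} = (p - 1) * (p * ((p - 1) * p)) := by
  have hS (θ : {θ : Param p // θ.g ≠ 0}) : θ.1.S = 0 :=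
    (mul_eq_zero.1 θ.1.gS).resolve_left θ.2
  let f : {θ : Param p // θ.g ≠ 0} ≃
      {g : ZMod p // g ≠ 0} × ZMod p × {d : ZMod p // d ≠ 0} × ZMod p :=
    { toFun θ := (⟨θ.1.g, θ.2⟩, θ.1.Q, ⟨θ.1.P - θ.1.Q, sub_ne_zero.2 θ.1.ne⟩, θ.1.R)
      invFun t := ⟨⟨t.1, t.2.1 + t.2.2.1, t.2.1, t.2.2.2, 0, mul_zero _,
        by simpa using t.2.2.1.2⟩, t.1.2⟩
      left_inv θ := by ext <;> simp [hS θ]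
      right_inv t := by simp }
  simp [Nat.card_congr f]

end Param

namespace Frame

variable {p : ℕ} [Fact p.Prime] {V : Type*} [AddCommGroup V] [Module (ZMod p) V]

theorem exists_of_linearIndependent (hV : Module.finrank (ZMod p) V = 3) {z v : V}
    (h : LinearIndependent (ZMod p) ![z, v]) : ∃ F : Frame p V, F.z = z ∧ F.v = v := by
  obtain ⟨e, he⟩ := exists_linearIndependent_cons_of_lt_finrank h (by rw [hV]; norm_num)
  let b := basisOfLinearIndependentOfCardEqFinrank he (by simp [hV])
  have hb (i) : b i = (Fin.cons e ![z, v] : Fin 3 → V) i := by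
    simp [b]
  have h0 : b 0 = e := by simp [hb]
  have h1 : b 1 = z := by rw [hb]; rfl
  have h2 : b 2 = v := by rw [hb]; rfl
  refine ⟨⟨e, v, z, b.coord 0, b.coord 2, b.coord 1, ?_, ?_, ?_, ?_, ?_, ?_, ?_, ?_, ?_, ?_⟩,
    rfl, rfl⟩
  · simp [← h0]
  · simp [← h2]
  · simp [← h1]
  · simp [← h0]
  · simp [← h2]
  · simp [← h1]
  · simp [← h0]
  · simp [← h2]
  · simp [← h1]
  · intro a
    conv_lhs => rw [← b.sum_repr a, Fin.sum_univ_three, h0, h1, h2]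
    simp only [Module.Basis.coord_apply]
    abel

variable (F : Frame p V) (θ : Param p) (h2 : (2 : ZMod p) ≠ 0)

theorem card_isFlag_of_g_eq_zero (hg : θ.g = 0) :
    Nat.card {s : V × V // IsFlag p (F.nsub θ h2) s.1 s.2} = (p - 1) * ((p * p - 1) * p) := by
  let f : {s : V × V // IsFlag p (F.nsub θ h2) s.1 s.2} ≃
      {t : ZMod p // t ≠ 0} × {w : ZMod p × ZMod p // w ≠ 0} × ZMod p :=
    { toFun s := (⟨F.x₃ s.1.1, ((F.isFlag_nsub_iff θ h2 _ _).1 s.2).1.2.2⟩,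
        ⟨(F.x₁ s.1.2, F.x₂ s.1.2), fun h => ((F.isFlag_nsub_iff θ h2 _ _).1 s.2).2.2
          (Prod.mk_eq_zero.1 h)⟩, F.x₃ s.1.2)
      invFun t := ⟨(t.1.1 • F.z, t.2.1.1.1 • F.e + t.2.1.1.2 • F.v + t.2.2 • F.z), by
        have := t.2.1.2
        rw [Ne, Prod.ext_iff] at this
        rw [isFlag_nsub_iff]
        simpa [hg, t.1.2] using this⟩
      left_inv s := by
        have hs := (F.isFlag_nsub_iff θ h2 _ _).1 s.2
        apply Subtype.ext
        apply Prod.ext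
        · apply F.ext_coords <;> simp [hs.1]
        · apply F.ext_coords <;> simp
      right_inv t := by simp }
  simp [Nat.card_congr f]

theorem card_isFlag_of_g_ne_zero (hg : θ.g ≠ 0) :
    Nat.card {s : V × V // IsFlag p (F.nsub θ h2) s.1 s.2} = (p - 1) * ((p - 1) * p) := by
  have key {z v : V} : IsFlag p (F.nsub θ h2) z v ↔
      (F.x₁ z = 0 ∧ F.x₂ z = 0 ∧ F.x₃ z ≠ 0) ∧ F.x₁ v = 0 ∧ F.x₂ v ≠ 0 := by
    rw [isFlag_nsub_iff]
    simp only [mul_eq_zero, hg, false_or]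
    tauto
  let f : {s : V × V // IsFlag p (F.nsub θ h2) s.1 s.2} ≃
      {t : ZMod p // t ≠ 0} × {t : ZMod p // t ≠ 0} × ZMod p :=
    { toFun s := (⟨F.x₃ s.1.1, (key.1 s.2).1.2.2⟩, ⟨F.x₂ s.1.2, (key.1 s.2).2.2⟩, F.x₃ s.1.2)
      invFun t := ⟨(t.1.1 • F.z, t.2.1.1 • F.v + t.2.2 • F.z), by
        rw [key]
        simpa [t.1.2] using t.2.1.2⟩
      left_inv s := by
        have hs := key.1 s.2
        apply Subtype.ext
        apply Prod.ext
        · apply F.ext_coords <;> simp [hs.1]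
        · apply F.ext_coords <;> simp [hs.2.1]
      right_inv t := by simp }
  simp [Nat.card_congr f]

/-- The subgroups adapted to a frame correspond to parameters. -/
theorem card_isHeisSub_of_isFlag (h3 : (3 : ZMod p) ≠ 0) {P : Subgroup (Equiv.Perm V) → Prop}
    {Q : Param p → Prop} (hPQ : ∀ θ, P (F.nsub θ h2) ↔ Q θ)
    (hQ : ∀ θ, IsFlag p (F.nsub θ h2) F.z F.v) :
    Nat.card {N : {N : Subgroup (Equiv.Perm V) // IsHeisSub p N ∧ P N} //
      IsFlag p N.1 F.z F.v} = Nat.card {θ // Q θ} := by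
  refine (Nat.card_eq_of_bijective (fun θ : {θ // Q θ} =>
    (⟨⟨F.nsub θ.1 h2, F.nsub_isHeisSub θ.1 h2 h3, (hPQ θ.1).2 θ.2⟩, hQ θ.1⟩ :
      {N : {N : Subgroup (Equiv.Perm V) // IsHeisSub p N ∧ P N} // IsFlag p N.1 F.z F.v}))
    ⟨fun θ θ' h => ?_, fun N => ?_⟩).symm
  · exact Subtype.ext (F.nsub_injective h2 (congrArg (fun N => N.1.1) h))
  · obtain ⟨⟨N, hN, hP⟩, hf⟩ := N
    obtain ⟨θ, rfl⟩ := F.exists_eq_nsub h2 hN hf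
    exact ⟨⟨θ, (hPQ θ).1 hP⟩, rfl⟩

end Frame

section Count

variable {p : ℕ} [Fact p.Prime] {V : Type*} [AddCommGroup V] [Module (ZMod p) V]

theorem card_linearIndependent_pair [Finite V] (hV : Module.finrank (ZMod p) V = 3) :
    Nat.card {s : V × V // LinearIndependent (ZMod p) ![s.1, s.2]} =
      (p ^ 3 - 1) * (p ^ 3 - p) := by
  have := Fintype.ofFinite V
  have h := card_linearIndependent (K := ZMod p) (V := V) (k := 2) (by rw [hV]; norm_num)
  rw [hV] at h
  simp only [ZMod.card, Fin.prod_univ_two, Fin.val_zero, Fin.val_one, pow_zero, pow_one] at h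
  rw [← h]
  refine Nat.card_congr ((finTwoArrowEquiv V).symm.subtypeEquiv fun s => ?_)
  rfl

theorem card_isHeisSub_mul [Finite V] (hV : Module.finrank (ZMod p) V = 3)
    (h2 : (2 : ZMod p) ≠ 0) (h3 : (3 : ZMod p) ≠ 0) {P : Subgroup (Equiv.Perm V) → Prop}
    {Q : Param p → Prop} (hPQ : ∀ (F : Frame p V) θ, P (F.nsub θ h2) ↔ Q θ) {m n : ℕ}
    (hm : ∀ (F : Frame p V) θ, Q θ →
      Nat.card {s : V × V // IsFlag p (F.nsub θ h2) s.1 s.2} = m)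
    (hn : Nat.card {θ // Q θ} = n) :
    Nat.card {N : Subgroup (Equiv.Perm V) // IsHeisSub p N ∧ P N} * m =
      (p ^ 3 - 1) * (p ^ 3 - p) * n := by
  have hcard : Nat.card V = p ^ 3 := by
    rw [Module.natCard_eq_pow_finrank (K := ZMod p), hV, Nat.card_zmod]
  rw [← card_linearIndependent_pair hV]
  refine Nat.card_mul_eq_card_mul_of_relation (fun N s => IsFlag p N.1 s.1.1 s.1.2) ?_ ?_
  · rintro ⟨N, hN, hP⟩
    obtain ⟨z, v, hf⟩ := hN.exists_isFlag hcard
    obtain ⟨F, rfl, rfl⟩ := Frame.exists_of_linearIndependent hV hf.indep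
    obtain ⟨θ, rfl⟩ := F.exists_eq_nsub h2 hN hf
    rw [← hm F θ ((hPQ F θ).1 hP)]
    exact Nat.card_congr (Equiv.subtypeSubtypeEquivSubtype
      (p := fun s : V × V => LinearIndependent (ZMod p) ![s.1, s.2])
      (q := fun s : V × V => IsFlag p (F.nsub θ h2) s.1 s.2) fun h => h.indep)
  · rintro ⟨⟨z, v⟩, hs⟩
    obtain ⟨F, rfl, rfl⟩ := Frame.exists_of_linearIndependent hV hs
    rw [← hn]
    exact F.card_isHeisSub_of_isFlag h2 h3 (hPQ F) fun θ => by
      rw [F.isFlag_nsub_iff]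
      simp

theorem card_isHeisSub [Finite V] (hV : Module.finrank (ZMod p) V = 3) (hp : 3 < p) :
    Nat.card {N : Subgroup (Equiv.Perm V) // IsHeisSub p N} =
      (p ^ 3 - 1) * (p ^ 2 + p - 1) * p ^ 2 := by
  have hne (k : ℕ) (h0 : 0 < k) (hk : k < p) : (k : ZMod p) ≠ 0 := fun h =>
    absurd (Nat.le_of_dvd h0 ((ZMod.natCast_eq_zero_iff k p).1 h)) (by lia)
  have h2 : (2 : ZMod p) ≠ 0 := mod_cast hne 2 (by norm_num) (by lia)
  have h3 : (3 : ZMod p) ≠ 0 := mod_cast hne 3 (by norm_num) hp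
  have hflat := card_isHeisSub_mul hV h2 h3 (P := IsFlat) (fun F θ => F.isFlat_nsub_iff θ h2)
    (fun F θ hg => F.card_isFlag_of_g_eq_zero θ h2 hg) Param.card_g_eq_zero
  have hnonflat := card_isHeisSub_mul hV h2 h3 (P := fun N => ¬ IsFlat N)
    (fun F θ => (F.isFlat_nsub_iff θ h2).not)
    (fun F θ hg => F.card_isFlag_of_g_ne_zero θ h2 hg) Param.card_g_ne_zero
  have hsum : Nat.card {N : Subgroup (Equiv.Perm V) // IsHeisSub p N} =
      Nat.card {N : Subgroup (Equiv.Perm V) // IsHeisSub p N ∧ IsFlat N} +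
      Nat.card {N : Subgroup (Equiv.Perm V) // IsHeisSub p N ∧ ¬ IsFlat N} := by
    classical
    rw [← Nat.card_sum]
    refine Nat.card_congr ((Equiv.sumCompl fun N : {N : Subgroup (Equiv.Perm V) //
      IsHeisSub p N} => IsFlat N.1).symm.trans (Equiv.sumCongr ?_ ?_))
    · exact Equiv.subtypeSubtypeEquivSubtypeInter _ _
    · exact Equiv.subtypeSubtypeEquivSubtypeInter _ fun N => ¬ IsFlat N
  rw [hsum]
  generalize Nat.card {N : Subgroup (Equiv.Perm V) // IsHeisSub p N ∧ IsFlat N} = A at *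
  generalize Nat.card {N : Subgroup (Equiv.Perm V) // IsHeisSub p N ∧ ¬ IsFlat N} = B at *
  have hp1 : 1 ≤ p := by lia
  have e1 : ((p - 1 : ℕ) : ℤ) = p - 1 := by push_cast [hp1]; ring
  have e2 : ((p * p - 1 : ℕ) : ℤ) = p * p - 1 := by
    rw [Nat.cast_sub (Nat.mul_pos hp1 hp1)]; push_cast; ring
  have e3 : ((p ^ 3 - 1 : ℕ) : ℤ) = p ^ 3 - 1 := by
    rw [Nat.cast_sub (Nat.one_le_pow _ _ hp1)]; push_cast; ring
  have e4 : ((p ^ 3 - p : ℕ) : ℤ) = p ^ 3 - p := by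
    rw [Nat.cast_sub (Nat.le_self_pow (by norm_num) p)]; push_cast; ring
  have e5 : ((p ^ 2 + p - 1 : ℕ) : ℤ) = p ^ 2 + p - 1 := by
    rw [Nat.cast_sub (by lia)]; push_cast; ring
  have hpz : (3 : ℤ) < p := mod_cast hp
  zify at hflat hnonflat ⊢
  rw [e1, e2, e3, e4] at hflat
  rw [e1, e3, e4] at hnonflat
  rw [e3, e5]
  have hm1 : ((p : ℤ) - 1) * ((p * p - 1) * p) ≠ 0 :=
    mul_ne_zero (by lia) (mul_ne_zero (by nlinarith) (by lia))
  have hm2 : ((p : ℤ) - 1) * ((p - 1) * p) ≠ 0 :=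
    mul_ne_zero (by lia) (mul_ne_zero (by lia) (by lia))
  have hA : (A : ℤ) = (p ^ 3 - 1) * p ^ 3 := mul_right_cancel₀ hm1 (by rw [hflat]; ring)
  have hB : (B : ℤ) = (p ^ 3 - 1) * (p ^ 3 - p) * p :=
    mul_right_cancel₀ hm2 (by rw [hnonflat]; ring)
  rw [hA, hB]
  ring

end Count

/-- Let `G = (ZMod p)³` be elementary abelian of order `p³`. The number of
regular subgroups of `Perm(G)` isomorphic to the Heisenberg group `M₁` and normalized by the
image of the left regular representation of `G` equals `(p³ − 1)(p² + p − 1)p²`; this is the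
number of Hopf–Galois structures of type `M₁` on a Galois extension with Galois group
`C_p³`. -/
theorem hopf_galois_structures_M1_type_on_Cp3 (p : ℕ) [Fact p.Prime] (h3 : 3 < p) :
    Nat.card {N : Subgroup (Equiv.Perm (Multiplicative (ZMod p × ZMod p × ZMod p))) //
      IsRegularSub N ∧ Nonempty (N ≃* Heisenberg p) ∧
      ∀ g : Multiplicative (ZMod p × ZMod p × ZMod p), ∀ n ∈ N,
        MulAction.toPermHom (Multiplicative (ZMod p × ZMod p × ZMod p))
            (Multiplicative (ZMod p × ZMod p × ZMod p)) g * n *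
          (MulAction.toPermHom (Multiplicative (ZMod p × ZMod p × ZMod p))
            (Multiplicative (ZMod p × ZMod p × ZMod p)) g)⁻¹ ∈ N} =
    (p ^ 3 - 1) * (p ^ 2 + p - 1) * p ^ 2 := by
  have : Module.finrank (ZMod p) (ZMod p × ZMod p × ZMod p) = 3 := by simp
  rw [← card_isHeisSub this h3]
  refine Nat.card_congr (Equiv.subtypeEquivRight fun N => ?_)
  exact ⟨fun h => ⟨h.1, h.2.1, h.2.2⟩, fun h => ⟨h.1, h.2, h.3⟩⟩
end

section
/- Let p > 3 be prime. Every Sylow p-subgroup of Aut(M₁) is isomorphic to M₁ itself, and Aut(M₁) has exactly p + 1 Sylow p-subgroups. In particular, the subgroup ⟨α₁, α₂, α₃⟩ of Aut(M₁) is a Sylow p-subgroup isomorphic to M₁, with relations α₂α₁ = α₁α₂, α₃α₁ = α₁α₃, α₃α₂ = α₁α₂α₃. -/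
open Heisenberg

namespace Heisenberg

variable {p : ℕ}

theorem σ_pow (n : ℕ) : (σ : Heisenberg p) ^ n = ⟨n, 0, 0⟩ := by
  induction n with
  | zero => ext <;> simp
  | succ n ih => rw [pow_succ, ih]; ext <;> simp [σ]

theorem τ_pow (n : ℕ) : (τ : Heisenberg p) ^ n = ⟨0, n, 0⟩ := by
  induction n with
  | zero => ext <;> simp
  | succ n ih => rw [pow_succ, ih]; ext <;> simp [τ]

theorem ρ_pow (n : ℕ) : (ρ : Heisenberg p) ^ n = ⟨0, 0, n⟩ := by
  induction n with
  | zero => ext <;> simp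
  | succ n ih => rw [pow_succ, ih]; ext <;> simp [ρ]

theorem τ_mul_σ : (τ * σ : Heisenberg p) = ρ * (σ * τ) := by
  ext <;> simp [σ, τ, ρ]

theorem card_eq_s8 : Nat.card (Heisenberg p) = p ^ 3 := by
  have e : Heisenberg p ≃ ZMod p × ZMod p × ZMod p :=
    ⟨fun g => (g.x, g.y, g.z), fun t => ⟨t.1, t.2.1, t.2.2⟩, fun _ => rfl, fun _ => rfl⟩
  rw [Nat.card_congr e]
  simp only [Nat.card_prod, Nat.card_zmod]
  ring

variable [Fact p.Prime]

instance : Finite (Heisenberg p) :=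
  Finite.of_injective (fun g : Heisenberg p => (g.x, g.y, g.z)) fun g h e => by
    simp only [Prod.mk.injEq] at e
    exact Heisenberg.ext e.1 e.2.1 e.2.2

theorem eq_pow_mul_pow_mul_pow (g : Heisenberg p) :
    g = σ ^ g.x.val * τ ^ g.y.val * ρ ^ g.z.val := by
  rw [σ_pow, τ_pow, ρ_pow]
  ext <;> simp

theorem closure_generators :
    Subgroup.closure {(ρ : Heisenberg p), σ, τ} = ⊤ := by
  refine eq_top_iff.mpr fun g _ => ?_
  rw [eq_pow_mul_pow_mul_pow g]
  have hmem : ∀ h ∈ ({(ρ : Heisenberg p), σ, τ} : Set _), h ∈ Subgroup.closure {ρ, σ, τ} :=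
    fun h hh => Subgroup.subset_closure hh
  exact mul_mem (mul_mem (pow_mem (hmem _ (by simp)) _) (pow_mem (hmem _ (by simp)) _))
    (pow_mem (hmem _ (by simp)) _)

theorem mulAut_ext {f g : MulAut (Heisenberg p)} (hσ : f σ = g σ) (hτ : f τ = g τ) : f = g := by
  have hρ : f ρ = g ρ := by
    have h := congrArg f (τ_mul_σ (p := p))
    have h' := congrArg g (τ_mul_σ (p := p))
    simp only [map_mul, hσ, hτ] at h h'
    exact mul_right_cancel (h.symm.trans h')
  have key : f.toMonoidHom = g.toMonoidHom := by
    refine MonoidHom.eq_of_eqOn_dense closure_generators ?_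
    rintro x (rfl | rfl | rfl)
    exacts [hρ, hσ, hτ]
  exact MulEquiv.ext fun x => DFunLike.congr_fun key x

/-- A homomorphism to the additive group of `ZMod p` is linear in the first two coordinates. -/
theorem additive_apply (ψ : Heisenberg p → ZMod p) (hψ : ∀ g h, ψ (g * h) = ψ g + ψ h)
    (g : Heisenberg p) : ψ g = ψ σ * g.x + ψ τ * g.y := by
  have h1 : ψ 1 = 0 := by simpa using hψ 1 1
  have hpow : ∀ (g : Heisenberg p) (n : ℕ), ψ (g ^ n) = ψ g * n := by
    intro g n
    induction n with
    | zero => simp [h1]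
    | succ n ih => rw [pow_succ, hψ, ih]; push_cast; ring
  have hρ : ψ ρ = 0 := by
    have h := congrArg ψ (τ_mul_σ (p := p))
    simp only [hψ] at h
    linear_combination -h
  conv_lhs => rw [eq_pow_mul_pow_mul_pow g]
  simp [hψ, hpow, hρ]

theorem mulAut_apply_x (f : MulAut (Heisenberg p)) (g : Heisenberg p) :
    (f g).x = (f σ).x * g.x + (f τ).x * g.y :=
  additive_apply (fun g => (f g).x) (by simp) g

theorem mulAut_apply_y (f : MulAut (Heisenberg p)) (g : Heisenberg p) :
    (f g).y = (f σ).y * g.x + (f τ).y * g.y :=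
  additive_apply (fun g => (f g).y) (by simp) g

theorem mulAut_det_ne_zero (f : MulAut (Heisenberg p)) :
    (f σ).x * (f τ).y - (f τ).x * (f σ).y ≠ 0 := by
  intro h
  have hx : (f ρ).x = 0 := by rw [mulAut_apply_x]; simp [ρ]
  have hy : (f ρ).y = 0 := by rw [mulAut_apply_y]; simp [ρ]
  have hz : (f ρ).z = 0 := by
    have h' := congrArg (fun g => (f g).z) (τ_mul_σ (p := p))
    simp only [map_mul, mul_z, mul_x, hy] at h'
    linear_combination h - h'
  have hρ : (ρ : Heisenberg p) = 1 := f.injective (by rw [map_one]; exact Heisenberg.ext hx hy hz)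
  exact one_ne_zero (congrArg Heisenberg.z hρ)

theorem mulAut_fst_ne_zero {f : MulAut (Heisenberg p)} (hf : (f τ).x = 0) : (f σ).x ≠ 0 :=
  fun h => mulAut_det_ne_zero f (by simp [h, hf])

theorem mulAut_snd_ne_zero {f : MulAut (Heisenberg p)} (hf : (f τ).x = 0) : (f τ).y ≠ 0 :=
  fun h => mulAut_det_ne_zero f (by simp [h, hf])

theorem two_ne_zero_of_ne_two (hp : p ≠ 2) : (2 : ZMod p) ≠ 0 :=
  Ring.two_ne_zero (by rwa [ZMod.ringChar_zmod_n])

/-- The automorphism `α₁ ^ c * α₂ ^ a * α₃ ^ b` attached to the element `ρ ^ c σ ^ a τ ^ b`. -/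
def unipotentAut (hp : p ≠ 2) (k : Heisenberg p) : MulAut (Heisenberg p) where
  toFun g := ⟨g.x, k.x * g.x + g.y, g.z + k.y * g.y + k.x * (g.x * (g.x - 1) / 2) + k.z * g.x⟩
  invFun g := ⟨g.x, g.y - k.x * g.x,
    g.z - k.y * (g.y - k.x * g.x) - k.x * (g.x * (g.x - 1) / 2) - k.z * g.x⟩
  left_inv g := by ext <;> simp; ring
  right_inv g := by ext <;> simp; ring
  map_mul' g h := by
    have h2 := two_ne_zero_of_ne_two hp
    ext <;> simp
    · ring
    · field_simp
      ring

/-- The embedding of the Heisenberg group in its automorphism group with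
`ρ ↦ α₁`, `σ ↦ α₂`, `τ ↦ α₃`. -/
def unipotentHom (hp : p ≠ 2) : Heisenberg p →* MulAut (Heisenberg p) where
  toFun := unipotentAut hp
  map_one' := by
    refine MulEquiv.ext fun g => ?_
    ext <;> simp [unipotentAut]
  map_mul' k l := by
    refine MulEquiv.ext fun g => ?_
    ext <;> simp [unipotentAut] <;> ring

theorem unipotentHom_σ (hp : p ≠ 2) (k : Heisenberg p) :
    unipotentHom hp k σ = ⟨1, k.x, k.z⟩ := by
  ext <;> simp [unipotentHom, unipotentAut, σ]

theorem unipotentHom_τ (hp : p ≠ 2) (k : Heisenberg p) :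
    unipotentHom hp k τ = ⟨0, 1, k.y⟩ := by
  ext <;> simp [unipotentHom, unipotentAut, τ]

theorem unipotentHom_injective (hp : p ≠ 2) :
    Function.Injective (unipotentHom (p := p) hp) := by
  intro k l h
  have h1 := congrArg (fun f => f σ) h
  have h2 := congrArg (fun f => f τ) h
  simp only [unipotentHom_σ, unipotentHom_τ, Heisenberg.mk.injEq] at h1 h2
  exact Heisenberg.ext h1.2.1 h2.2.2 h1.2.2

theorem mem_range_unipotentHom (hp : p ≠ 2) (f : MulAut (Heisenberg p)) :
    f ∈ (unipotentHom hp).range ↔ (f σ).x = 1 ∧ (f τ).x = 0 ∧ (f τ).y = 1 := by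
  constructor
  · rintro ⟨k, rfl⟩
    simp [unipotentHom_σ, unipotentHom_τ]
  · rintro ⟨h1, h2, h3⟩
    refine ⟨⟨(f σ).y, (f τ).z, (f σ).z⟩, mulAut_ext ?_ ?_⟩
    · rw [unipotentHom_σ]; exact Heisenberg.ext h1.symm rfl rfl
    · rw [unipotentHom_τ]; exact Heisenberg.ext h2.symm h3.symm rfl

theorem range_unipotentHom (hp : p ≠ 2) :
    (unipotentHom hp).range = Subgroup.closure {α₁ (p := p), α₂ p hp, α₃ (p := p)} := by
  have h1 : unipotentHom hp ρ = α₁ := by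
    refine MulEquiv.ext fun g => ?_
    ext <;> simp [unipotentHom, unipotentAut, α₁, ρ]
  have h2 : unipotentHom hp σ = α₂ p hp := by
    refine MulEquiv.ext fun g => ?_
    ext <;> simp [unipotentHom, unipotentAut, α₂, σ]
  have h3 : unipotentHom hp τ = α₃ := by
    refine MulEquiv.ext fun g => ?_
    ext <;> simp [unipotentHom, unipotentAut, α₃, τ]
  rw [MonoidHom.range_eq_map, ← closure_generators, MonoidHom.map_closure]
  simp only [Set.image_insert_eq, Set.image_singleton, h1, h2, h3]

theorem mulAut_mul_σ_x (f g : MulAut (Heisenberg p)) :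
    ((f * g) σ).x = (f σ).x * (g σ).x + (f τ).x * (g σ).y :=
  mulAut_apply_x f (g σ)

theorem mulAut_mul_τ_x (f g : MulAut (Heisenberg p)) :
    ((f * g) τ).x = (f σ).x * (g τ).x + (f τ).x * (g τ).y :=
  mulAut_apply_x f (g τ)

theorem mulAut_mul_τ_y (f g : MulAut (Heisenberg p)) :
    ((f * g) τ).y = (f σ).y * (g τ).x + (f τ).y * (g τ).y :=
  mulAut_apply_y f (g τ)

theorem mem_normalizer_range_unipotentHom (hp : p ≠ 2) (f : MulAut (Heisenberg p)) :
    f ∈ Subgroup.normalizer ((unipotentHom hp).range : Set (MulAut (Heisenberg p))) ↔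
      (f τ).x = 0 := by
  rw [Subgroup.mem_normalizer_iff]
  constructor
  · intro h
    have h1 := (h _).mp ⟨σ, rfl⟩
    set k := unipotentHom hp σ with hk
    set l := f * k * f⁻¹ with hl
    have hlf : l * f = f * k := by simp [hl]
    obtain ⟨ha, hb, -⟩ := (mem_range_unipotentHom hp l).mp h1
    have e := mulAut_mul_σ_x l f
    rw [hlf, mulAut_mul_σ_x, ha, hb, hk, unipotentHom_σ] at e
    simpa [σ] using e
  · intro hf k
    set l := f * k * f⁻¹ with hl
    have hlf : l * f = f * k := by simp [hl]
    have hfa := mulAut_fst_ne_zero hf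
    have hfd := mulAut_snd_ne_zero hf
    have e1 := mulAut_mul_σ_x l f
    have e2 := mulAut_mul_τ_x l f
    have e3 := mulAut_mul_τ_y l f
    rw [hlf, mulAut_mul_σ_x, hf] at e1
    rw [hlf, mulAut_mul_τ_x, hf] at e2
    rw [hlf, mulAut_mul_τ_y, hf] at e3
    rw [mem_range_unipotentHom, mem_range_unipotentHom]
    constructor
    · rintro ⟨ha, hb, hd⟩
      rw [hb] at e2 e3
      rw [ha] at e1
      rw [hd] at e3
      have hlb : (l τ).x = 0 := by
        have : (l τ).x * (f τ).y = 0 := by linear_combination -e2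
        exact (mul_eq_zero.mp this).resolve_right hfd
      rw [hlb] at e1
      exact ⟨mul_right_cancel₀ hfa (by linear_combination -e1), hlb,
        mul_right_cancel₀ hfd (by linear_combination -e3)⟩
    · rintro ⟨ha, hb, hd⟩
      rw [hb] at e1 e2
      rw [ha] at e1
      rw [hd] at e3
      have hkb : (k τ).x = 0 := by
        have : (f σ).x * (k τ).x = 0 := by linear_combination e2
        exact (mul_eq_zero.mp this).resolve_left hfa
      rw [hkb] at e3
      exact ⟨mul_left_cancel₀ hfa (by linear_combination e1), hkb,
        mul_left_cancel₀ hfd (by linear_combination e3)⟩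

/-- The diagonal entries of an automorphism normalizing the unipotent subgroup. -/
def diagonalHom (hp : p ≠ 2) :
    Subgroup.normalizer ((unipotentHom hp).range : Set (MulAut (Heisenberg p))) →*
      ZMod p × ZMod p where
  toFun f := ((f.1 σ).x, (f.1 τ).y)
  map_one' := by simp [σ, τ]
  map_mul' f g := by
    have hf := (mem_normalizer_range_unipotentHom hp f.1).mp f.2
    have hg := (mem_normalizer_range_unipotentHom hp g.1).mp g.2
    simp only [Subgroup.coe_mul, mulAut_mul_σ_x, mulAut_mul_τ_y, hf, hg]
    simp

theorem ker_diagonalHom (hp : p ≠ 2) :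
    (diagonalHom hp).toHomUnits.ker =
      (unipotentHom hp).range.subgroupOf
        (Subgroup.normalizer ((unipotentHom hp).range : Set (MulAut (Heisenberg p)))) := by
  ext f
  have hf := (mem_normalizer_range_unipotentHom hp f.1).mp f.2
  rw [MonoidHom.mem_ker, Subgroup.mem_subgroupOf, mem_range_unipotentHom, Units.ext_iff,
    MonoidHom.coe_toHomUnits]
  change ((f.1 σ).x, (f.1 τ).y) = (1, 1) ↔ _
  simp [hf]

theorem not_dvd_relIndex_normalizer (hp : p ≠ 2) :
    ¬ p ∣ (unipotentHom hp).range.relIndex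
      (Subgroup.normalizer ((unipotentHom hp).range : Set (MulAut (Heisenberg p)))) := by
  have hpp : p.Prime := Fact.out
  rw [Subgroup.relIndex, ← ker_diagonalHom, Subgroup.index_ker]
  intro h
  have h' := h.trans (Subgroup.card_subgroup_dvd_card _)
  rw [Nat.card_congr MulEquiv.prodUnits.toEquiv, Nat.card_prod, Nat.card_eq_fintype_card,
    ZMod.card_units, hpp.dvd_mul, or_self] at h'
  have h1 := hpp.two_le
  have h2 := Nat.le_of_dvd (by omega) h'
  omega

/-- The automorphism `σ ↦ τ⁻¹`, `τ ↦ σ`. -/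
def swapAut : MulAut (Heisenberg p) where
  toFun g := ⟨g.y, -g.x, g.z - g.x * g.y⟩
  invFun g := ⟨-g.y, g.x, g.z - g.x * g.y⟩
  left_inv g := by ext <;> simp; ring
  right_inv g := by ext <;> simp; ring
  map_mul' g h := by ext <;> simp <;> ring

/-- The slope of the line spanned by the image of `τ` modulo the centre, `none` for the line
spanned by `τ` itself. -/
def slope (f : MulAut (Heisenberg p)) : Option (ZMod p) :=
  if (f τ).x = 0 then none else some ((f τ).y / (f τ).x)

theorem slope_eq_iff (hp : p ≠ 2) (f g : MulAut (Heisenberg p)) :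
    slope f = slope g ↔
      f⁻¹ * g ∈ Subgroup.normalizer ((unipotentHom hp).range : Set (MulAut (Heisenberg p))) := by
  rw [mem_normalizer_range_unipotentHom]
  have key : (g τ).x * (f τ).y - (g τ).y * (f τ).x =
      ((f⁻¹ * g) τ).x * ((f σ).x * (f τ).y - (f τ).x * (f σ).y) := by
    have e1 := mulAut_mul_τ_x f (f⁻¹ * g)
    have e2 := mulAut_mul_τ_y f (f⁻¹ * g)
    rw [mul_inv_cancel_left] at e1 e2
    rw [e1, e2]
    ring
  have hiff : ((f⁻¹ * g) τ).x = 0 ↔ (g τ).x * (f τ).y = (g τ).y * (f τ).x := by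
    rw [← sub_eq_zero (a := (g τ).x * (f τ).y), key, mul_eq_zero,
      or_iff_left (mulAut_det_ne_zero f)]
  rw [hiff]
  unfold slope
  by_cases hf : (f τ).x = 0 <;> by_cases hg : (g τ).x = 0
  · simp [hf, hg]
  · simp [hf, hg, mulAut_snd_ne_zero hf]
  · simp [hf, hg, mulAut_snd_ne_zero hg]
  · simp only [hf, hg, if_false, Option.some.injEq]
    rw [div_eq_div_iff hf hg, mul_comm]

theorem slope_surjective (hp : p ≠ 2) : Function.Surjective (slope (p := p)) := by
  rintro (_ | t)
  · exact ⟨1, by simp [slope, τ]⟩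
  · exact ⟨unipotentHom hp ⟨t, 0, 0⟩ * swapAut, by
      simp [slope, τ, swapAut, unipotentHom, unipotentAut]⟩

theorem index_normalizer_range_unipotentHom (hp : p ≠ 2) :
    (Subgroup.normalizer
      ((unipotentHom hp).range : Set (MulAut (Heisenberg p)))).index = p + 1 := by
  have hcard : Nat.card (Option (ZMod p)) = p + 1 := by simp
  rw [Subgroup.index, ← hcard]
  refine Nat.card_eq_of_bijective
    (Quotient.lift slope fun f g h =>
      (slope_eq_iff hp f g).mpr (QuotientGroup.leftRel_apply.mp h)) ⟨?_, ?_⟩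
  · rintro ⟨f⟩ ⟨g⟩ h
    exact Quotient.sound (QuotientGroup.leftRel_apply.mpr ((slope_eq_iff hp f g).mp h))
  · intro t
    obtain ⟨f, hf⟩ := slope_surjective hp t
    exact ⟨⟦f⟧, hf⟩

theorem not_dvd_index_range_unipotentHom (hp : p ≠ 2) :
    ¬ p ∣ (unipotentHom (p := p) hp).range.index := by
  have hpp : p.Prime := Fact.out
  rw [← Subgroup.relIndex_mul_index
    (Subgroup.le_normalizer (H := (unipotentHom (p := p) hp).range)), hpp.dvd_mul,
    index_normalizer_range_unipotentHom]
  rintro (h | h)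
  · exact not_dvd_relIndex_normalizer hp h
  · exact hpp.one_lt.ne' (Nat.dvd_one.mp ((Nat.dvd_add_right dvd_rfl).mp h))

/-- The image of `unipotentHom` as a Sylow `p`-subgroup. -/
noncomputable def unipotentSylow (hp : p ≠ 2) : Sylow p (MulAut (Heisenberg p)) :=
  ((IsPGroup.of_card card_eq_s8).of_equiv
    (MonoidHom.ofInjective (unipotentHom_injective hp))).toSylow
    (not_dvd_index_range_unipotentHom hp)

end Heisenberg

/-- Every Sylow `p`-subgroup of `Aut(M₁)` is isomorphic to `M₁`, there are
exactly `p + 1` of them, `⟨α₁, α₂, α₃⟩` is one of them, and the relations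
`α₂α₁ = α₁α₂`, `α₃α₁ = α₁α₃`, `α₃α₂ = α₁α₂α₃` hold. -/
theorem sylow_subgroups_of_aut_M1 (p : ℕ) [Fact p.Prime] (h3 : 3 < p) :
    (∀ P : Sylow p (MulAut (Heisenberg p)),
      Nonempty ((P : Subgroup (MulAut (Heisenberg p))) ≃* Heisenberg p)) ∧
    Nat.card (Sylow p (MulAut (Heisenberg p))) = p + 1 ∧
    (∃ P : Sylow p (MulAut (Heisenberg p)),
      (P : Subgroup (MulAut (Heisenberg p))) =
        Subgroup.closure {α₁ (p := p), α₂ p (by omega), α₃ (p := p)}) ∧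
    α₂ p (by omega) * α₁ = α₁ * α₂ p (by omega) ∧
    α₃ * α₁ = α₁ * (α₃ : MulAut (Heisenberg p)) ∧
    α₃ * α₂ p (by omega) = α₁ * α₂ p (by omega) * α₃ := by
  have hp : p ≠ 2 := by omega
  refine ⟨fun P => ?_, ?_, ⟨unipotentSylow hp, range_unipotentHom hp⟩, ?_, ?_, ?_⟩
  · exact ⟨(P.equiv (unipotentSylow hp)).trans
      (MonoidHom.ofInjective (unipotentHom_injective hp)).symm⟩
  · rw [(unipotentSylow hp).card_eq_index_normalizer]
    exact index_normalizer_range_unipotentHom hp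
  · refine MulEquiv.ext fun g => ?_
    ext <;> simp [α₁, α₂]; ring
  · refine MulEquiv.ext fun g => ?_
    ext <;> simp [α₁, α₃]; ring
  · refine MulEquiv.ext fun g => ?_
    ext <;> simp [α₁, α₂, α₃]; ring
end
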